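/- Let w ∈ A_1, 0 < β ≤ 1 and 2 < q < ∞. Then for every j ∈ ℕ and f ∈ L^1_loc(ℝ^n), ‖S_{β,2^j}(f)‖_{L^q_w} ≤ C 2^{jn/2} ‖S_β(f)‖_{L^q_w}, with C independent of j and f. -/

import Mathlib

open MeasureTheory Metric Set

noncomputable section

/-- `ℝⁿ` as a Euclidean space. -/
abbrev Rn (n : ℕ) : Type := EuclideanSpace ℝ (Fin n)

variable {n : ℕ}

/-- Weighted measure of a set: `w(E) = ∫_E w`. -/
def wMeas (w : Rn n → ℝ) (s : Set (Rn n)) : ℝ := ∫ x in s, w x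

/-- The Muckenhoupt `A₁` condition with constant `C`. -/
def IsA1 (w : Rn n → ℝ) (C : ℝ) : Prop :=
  (∀ x, 0 ≤ w x) ∧ MeasureTheory.LocallyIntegrable w ∧
    ∀ (x₀ : Rn n) (R : ℝ), 0 < R →
      (∫ x in ball x₀ R, w x) ≤
        C * (volume (ball x₀ R)).toReal * essInf w (volume.restrict (ball x₀ R))

/-- The Muckenhoupt `A_p` condition (`1 < p`) with constant `C`. -/
def IsAp (w : Rn n → ℝ) (p C : ℝ) : Prop :=
  (∀ x, 0 ≤ w x) ∧ MeasureTheory.LocallyIntegrable w ∧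
    ∀ (x₀ : Rn n) (R : ℝ), 0 < R →
      ((volume (ball x₀ R)).toReal⁻¹ * ∫ x in ball x₀ R, w x) *
        ((volume (ball x₀ R)).toReal⁻¹ * ∫ x in ball x₀ R, (w x) ^ (-(1 / (p - 1)))) ^ (p - 1)
        ≤ C

/-- The reverse Hölder condition `RH_r` with constant `C`. -/
def IsRH (w : Rn n → ℝ) (r C : ℝ) : Prop :=
  ∀ (x₀ : Rn n) (R : ℝ), 0 < R →
    ((volume (ball x₀ R)).toReal⁻¹ * ∫ x in ball x₀ R, (w x) ^ r) ^ (1 / r) ≤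
      C * ((volume (ball x₀ R)).toReal⁻¹ * ∫ x in ball x₀ R, w x)

/-- The class `C_β`: support in the closed unit ball, mean zero, β-Hölder with constant 1. -/
def MemCbeta (β : ℝ) (φ : Rn n → ℝ) : Prop :=
  (∀ x, φ x ≠ 0 → ‖x‖ ≤ 1) ∧ MeasureTheory.Integrable φ ∧ (∫ x, φ x) = 0 ∧
    ∀ x x' : Rn n, |φ x - φ x'| ≤ ‖x - x'‖ ^ β

/-- Convolution `f * φ_t (x)` with the dilation `φ_t(x) = t^{-n} φ(x/t)`. -/
def convPhi (f φ : Rn n → ℝ) (t : ℝ) (x : Rn n) : ℝ :=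
  ∫ y, f y * (t ^ (-(n : ℝ)) * φ (t⁻¹ • (x - y)))

/-- The intrinsic averaging function `A_β(f)(y,t) = sup_{φ ∈ C_β} |f * φ_t(y)|`. -/
def Abeta (β : ℝ) (f : Rn n → ℝ) (y : Rn n) (t : ℝ) : ℝ :=
  ⨆ φ : {φ : Rn n → ℝ // MemCbeta β φ}, |convPhi f φ.1 t y|

/-- The intrinsic Littlewood–Paley `g`-function. -/
def gbeta (β : ℝ) (f : Rn n → ℝ) (x : Rn n) : ℝ :=
  (∫ t in Ioi (0 : ℝ), (Abeta β f x t) ^ 2 / t) ^ (1 / 2 : ℝ)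

/-- The intrinsic Lusin area function of aperture `γ`. -/
def SbetaA (β γ : ℝ) (f : Rn n → ℝ) (x : Rn n) : ℝ :=
  (∫ p in {p : Rn n × ℝ | dist x p.1 < γ * p.2 ∧ 0 < p.2},
      (Abeta β f p.1 p.2) ^ 2 / p.2 ^ (n + 1)) ^ (1 / 2 : ℝ)

/-- The intrinsic `g^*_λ` function. -/
def gstar (lam β : ℝ) (f : Rn n → ℝ) (x : Rn n) : ℝ :=
  (∫ p in {p : Rn n × ℝ | 0 < p.2},
      (p.2 / (p.2 + dist x p.1)) ^ (lam * (n : ℝ)) * (Abeta β f p.1 p.2) ^ 2 / p.2 ^ (n + 1)) ^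
    (1 / 2 : ℝ)

/-- The weighted `L^q` norm `(∫ |g|^q w)^{1/q}`. -/
def wLq (q : ℝ) (w g : Rn n → ℝ) : ℝ := (∫ x, |g x| ^ q * w x) ^ (1 / q)

/-- The weighted Hardy–Littlewood maximal operator. -/
def Mw (w b : Rn n → ℝ) (x : Rn n) : ℝ :=
  ⨆ B : {B : Rn n × ℝ // 0 < B.2 ∧ x ∈ ball B.1 B.2},
    (wMeas w (ball B.1.1 B.1.2))⁻¹ * ∫ y in ball B.1.1 B.1.2, |b y| * w y

/-- A central `(α, q, 0; w₁, w₂)`-atom supported in `B(0,R)`. -/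
def IsCentralAtom (α q R : ℝ) (w₁ w₂ a : Rn n → ℝ) : Prop :=
  MeasureTheory.Integrable a ∧ (∀ x, a x ≠ 0 → x ∈ ball (0 : Rn n) R) ∧
    wLq q w₂ a ≤ (wMeas w₁ (ball (0 : Rn n) R)) ^ (-(α / (n : ℝ))) ∧
    (∫ x, a x) = 0

/-- The homogeneous weighted Herz norm `‖f‖_{\dot K^{α,p}_q(w₁,w₂)}`. -/
def herzNorm (α p q : ℝ) (w₁ w₂ f : Rn n → ℝ) : ℝ :=
  (∑' k : ℤ,
      (wMeas w₁ (closedBall (0 : Rn n) ((2 : ℝ) ^ k))) ^ (α * p / (n : ℝ)) *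
        ((∫ x in closedBall (0 : Rn n) ((2 : ℝ) ^ k) \ closedBall (0 : Rn n) ((2 : ℝ) ^ (k - 1)),
            |f x| ^ q * w₂ x) ^ (1 / q)) ^ p) ^ (1 / p)

section Maximal

open scoped ENNReal

variable {X : Type*} [MetricSpace X] [MeasurableSpace X]

/-- The uncentred maximal function of `b` with respect to `μ`, with values in `ℝ≥0∞`. -/
def maxFun (μ : Measure X) (b : X → ℝ≥0∞) (z : X) : ℝ≥0∞ :=
  ⨆ B : {B : X × ℝ // z ∈ ball B.1 B.2}, (∫⁻ y in ball B.1.1 B.1.2, b y ∂μ) / μ (ball B.1.1 B.1.2)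

lemma le_maxFun (μ : Measure X) (b : X → ℝ≥0∞) {z y : X} {r : ℝ} (hz : z ∈ ball y r) :
    (∫⁻ y in ball y r, b y ∂μ) / μ (ball y r) ≤ maxFun μ b z :=
  le_iSup (fun B : {B : X × ℝ // z ∈ ball B.1 B.2} =>
    (∫⁻ y in ball B.1.1 B.1.2, b y ∂μ) / μ (ball B.1.1 B.1.2)) ⟨(y, r), hz⟩

lemma lt_maxFun_iff (μ : Measure X) (b : X → ℝ≥0∞) (c : ℝ≥0∞) (z : X) :
    c < maxFun μ b z ↔ ∃ B : X × ℝ, z ∈ ball B.1 B.2 ∧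
      c < (∫⁻ y in ball B.1 B.2, b y ∂μ) / μ (ball B.1 B.2) := by
  rw [maxFun, lt_iSup_iff]
  constructor
  · rintro ⟨⟨B, hB⟩, h⟩
    exact ⟨B, hB, h⟩
  · rintro ⟨B, hB, h⟩
    exact ⟨⟨B, hB⟩, h⟩

lemma maxFun_le_of_le (μ : Measure X) {b : X → ℝ≥0∞} {N : ℝ≥0∞} (hb : ∀ x, b x ≤ N) (z : X) :
    maxFun μ b z ≤ N := by
  refine iSup_le fun B => ?_
  refine ENNReal.div_le_of_le_mul ?_
  calc ∫⁻ y in ball B.1.1 B.1.2, b y ∂μ ≤ ∫⁻ _ in ball B.1.1 B.1.2, N ∂μ :=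
        lintegral_mono fun x => hb x
    _ = N * μ (ball B.1.1 B.1.2) := setLIntegral_const _ _

variable [BorelSpace X]

lemma measurable_maxFun (μ : Measure X) (b : X → ℝ≥0∞) : Measurable (maxFun μ b) := by
  refine measurable_of_Ioi fun c => IsOpen.measurableSet ?_
  have : maxFun μ b ⁻¹' Ioi c = ⋃ B ∈ {B : X × ℝ |
      c < (∫⁻ y in ball B.1 B.2, b y ∂μ) / μ (ball B.1 B.2)}, ball B.1 B.2 := by
    ext z
    simp only [mem_preimage, mem_Ioi, lt_maxFun_iff, mem_iUnion, mem_ofPred_eq, exists_prop]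
    exact exists_congr fun B => and_comm
  rw [this]
  exact isOpen_biUnion fun B _ => isOpen_ball

variable [SecondCountableTopology X]

/-- Weak type `(1,1)` of the maximal function of a doubling measure. -/
lemma mul_measure_lt_maxFun_le {μ : Measure X} {K : ℝ≥0∞}
    (hK : ∀ x r, μ (ball x (4 * r)) ≤ K * μ (ball x r))
    (b : X → ℝ≥0∞) (c : ℝ≥0∞) :
    c * μ {z | c < maxFun μ b z} ≤ K * ∫⁻ x, b x ∂μ := by
  set S : Set (X × ℝ) := {B | c < (∫⁻ y in ball B.1 B.2, b y ∂μ) / μ (ball B.1 B.2)} with hS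
  have hSb : ∀ B ∈ S, c * μ (ball B.1 B.2) ≤ ∫⁻ y in ball B.1 B.2, b y ∂μ := fun B hB =>
    ENNReal.mul_le_of_le_div (le_of_lt hB)
  obtain ⟨T, hTS, hTc, hTU⟩ := TopologicalSpace.isOpen_biUnion_countable S
    (fun B : X × ℝ => ball B.1 B.2) (fun B _ => isOpen_ball)
  have hsub : {z | c < maxFun μ b z} ⊆ ⋃ B ∈ T, ball B.1 B.2 := by
    intro z hz
    obtain ⟨B, hB, h⟩ := (lt_maxFun_iff μ b c z).1 hz
    rw [hTU]
    exact mem_biUnion (show B ∈ S from h) hB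
  have hfinite : ∀ t : Finset T, c * μ (⋃ B ∈ t, ball (B : X × ℝ).1 (B : X × ℝ).2) ≤
      K * ∫⁻ x, b x ∂μ := by
    intro t
    obtain ⟨R, hR⟩ : ∃ R : ℝ, ∀ a ∈ (t : Set T), (a : X × ℝ).2 ≤ R := by
      obtain ⟨R, hR⟩ := (t.finite_toSet.image fun a : T => (a : X × ℝ).2).bddAbove
      exact ⟨R, fun a ha => hR (mem_image_of_mem _ ha)⟩
    obtain ⟨u, hut, hdisj, hcov⟩ := Vitali.exists_disjoint_subfamily_covering_enlargement_ball
      (t : Set T) (fun a => (a : X × ℝ).1) (fun a => (a : X × ℝ).2) R hR 4 (by norm_num)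
    have hu : u.Countable := (t.finite_toSet.subset hut).countable
    calc c * μ (⋃ B ∈ t, ball (B : X × ℝ).1 (B : X × ℝ).2)
        ≤ c * μ (⋃ B ∈ u, ball (B : X × ℝ).1 (4 * (B : X × ℝ).2)) := by
          refine mul_le_mul_right (measure_mono (iUnion₂_subset fun B hB => ?_)) _
          obtain ⟨B', hB', h⟩ := hcov B hB
          exact h.trans (subset_biUnion_of_mem (u := fun B : T =>
            ball (B : X × ℝ).1 (4 * (B : X × ℝ).2)) hB')
      _ ≤ c * ∑' B : u, μ (ball (B : X × ℝ).1 (4 * (B : X × ℝ).2)) := by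
          gcongr
          exact measure_biUnion_le μ hu _
      _ ≤ c * ∑' B : u, K * μ (ball (B : X × ℝ).1 (B : X × ℝ).2) := by
          gcongr
          exact hK _ _
      _ = K * ∑' B : u, c * μ (ball (B : X × ℝ).1 (B : X × ℝ).2) := by
          rw [ENNReal.tsum_mul_left, ENNReal.tsum_mul_left]; ring
      _ ≤ K * ∑' B : u, ∫⁻ y in ball (B : X × ℝ).1 (B : X × ℝ).2, b y ∂μ := by
          gcongr with B
          exact hSb _ (hTS B.1.2)
      _ = K * ∫⁻ y in ⋃ B ∈ u, ball (B : X × ℝ).1 (B : X × ℝ).2, b y ∂μ := by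
          rw [lintegral_biUnion hu (fun _ _ => measurableSet_ball) hdisj]
      _ ≤ K * ∫⁻ x, b x ∂μ := by
          gcongr
          exact Measure.restrict_le_self
  have : Countable T := hTc.to_subtype
  have hU : (⋃ B ∈ T, ball B.1 B.2) =
      ⋃ t : Finset T, ⋃ B ∈ t, ball (B : X × ℝ).1 (B : X × ℝ).2 := by
    ext z
    simp only [mem_iUnion, exists_prop]
    constructor
    · rintro ⟨B, hB, h⟩
      exact ⟨{⟨B, hB⟩}, ⟨B, hB⟩, Finset.mem_singleton_self _, h⟩
    · rintro ⟨t, B, _, h⟩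
      exact ⟨B, B.2, h⟩
  have hdir : Directed (· ⊆ ·)
      fun t : Finset T => ⋃ B ∈ t, ball (B : X × ℝ).1 (B : X × ℝ).2 := by
    classical
    refine directed_of_isDirected_le fun s t hst => ?_
    exact biUnion_subset_biUnion_left hst
  calc c * μ {z | c < maxFun μ b z} ≤ c * μ (⋃ B ∈ T, ball B.1 B.2) := by gcongr
    _ = ⨆ t : Finset T, c * μ (⋃ B ∈ t, ball (B : X × ℝ).1 (B : X × ℝ).2) := by
        rw [hU, hdir.measure_iUnion, ENNReal.mul_iSup]
    _ ≤ _ := iSup_le hfinite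

lemma mul_measure_lt_maxFun_le_setLIntegral {μ : Measure X} {K : ℝ≥0∞}
    (hfin : ∀ x r, μ (ball x r) ≠ ∞)
    (hK : ∀ x r, μ (ball x (4 * r)) ≤ K * μ (ball x r))
    {b : X → ℝ≥0∞} (hb : Measurable b) (c : ℝ≥0∞) :
    c * μ {z | c + c < maxFun μ b z} ≤ K * ∫⁻ x in {x | c < b x}, b x ∂μ := by
  have hm : MeasurableSet {x | c < b x} := measurableSet_lt measurable_const hb
  rw [← lintegral_indicator hm]
  refine le_trans ?_ (mul_measure_lt_maxFun_le hK ({x | c < b x}.indicator b) c)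
  refine mul_le_mul_right (measure_mono fun z hz => ?_) _
  simp only [mem_ofPred_eq, lt_maxFun_iff] at hz ⊢
  obtain ⟨B, hB, h⟩ := hz
  refine ⟨B, hB, ?_⟩
  have h1 : (∫⁻ y in ball B.1 B.2, b y ∂μ) / μ (ball B.1 B.2) ≤
      (∫⁻ y in ball B.1 B.2, {x | c < b x}.indicator b y ∂μ) / μ (ball B.1 B.2) + c := by
    refine ENNReal.div_le_of_le_mul ?_
    calc ∫⁻ y in ball B.1 B.2, b y ∂μ
        ≤ ∫⁻ y in ball B.1 B.2, ({x | c < b x}.indicator b y + c) ∂μ := by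
          refine lintegral_mono fun y => ?_
          by_cases hy : c < b y
          · simp [indicator, hy]
          · simpa [indicator, hy] using not_lt.1 hy
      _ = (∫⁻ y in ball B.1 B.2, {x | c < b x}.indicator b y ∂μ) + c * μ (ball B.1 B.2) := by
          rw [lintegral_add_right _ measurable_const, setLIntegral_const]
      _ ≤ _ := by
          rw [add_mul]
          gcongr
          by_cases h0 : μ (ball B.1 B.2) = 0
          · rw [setLIntegral_measure_zero _ _ h0]; exact zero_le
          · rw [ENNReal.div_mul_cancel h0 (hfin _ _)]
  by_contra hcon
  have := h.trans_le (h1.trans (add_le_add_left (not_lt.1 hcon) c))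
  exact lt_irrefl _ this

lemma lintegral_Ioo_rpow {s c : ℝ} (hs : 0 < s) (hc : 0 ≤ c) :
    ∫⁻ t in Ioo 0 c, ENNReal.ofReal (t ^ (s - 1)) = ENNReal.ofReal (c ^ s / s) := by
  rw [← ofReal_integral_eq_lintegral_ofReal]
  · rw [← integral_Ioc_eq_integral_Ioo, ← intervalIntegral.integral_of_le hc,
      integral_rpow (Or.inl (by linarith))]
    simp [hs.ne']
  · have := intervalIntegral.intervalIntegrable_rpow' (a := 0) (b := c) (r := s - 1) (by linarith)
    exact (this.1).mono_set Ioo_subset_Ioc_self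
  · filter_upwards [ae_restrict_mem measurableSet_Ioo] with t ht
    exact Real.rpow_nonneg ht.1.le _

/-- Strong type `(r,r)` of the maximal function of a doubling measure, on bounded functions. -/
lemma lintegral_maxFun_rpow_le {μ : Measure X} [SFinite μ] {K : ℝ≥0∞}
    (hfin : ∀ x r, μ (ball x r) ≠ ∞)
    (hK : ∀ x r, μ (ball x (4 * r)) ≤ K * μ (ball x r))
    {r : ℝ} (hr : 1 < r) {b : X → ℝ≥0∞} (hb : Measurable b) {N : ℝ≥0∞} (hN : N ≠ ∞)
    (hbN : ∀ x, b x ≤ N) :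
    ∫⁻ x, maxFun μ b x ^ r ∂μ ≤ ENNReal.ofReal (r * 2 ^ r / (r - 1)) * K * ∫⁻ x, b x ^ r ∂μ := by
  have hMtop : ∀ x, maxFun μ b x ≠ ∞ := fun x =>
    ne_top_of_le_ne_top hN (maxFun_le_of_le μ hbN x)
  have hbtop : ∀ x, b x ≠ ∞ := fun x => ne_top_of_le_ne_top hN (hbN x)
  have hpt : ∀ t ∈ Ioi (0 : ℝ), μ {x | t < (maxFun μ b x).toReal} * ENNReal.ofReal (t ^ (r - 1)) ≤
      2 * K * ∫⁻ x, b x * (Iio (2 * (b x).toReal)).indicator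
        (fun t => ENNReal.ofReal (t ^ ((r - 1) - 1))) t ∂μ := by
    intro t ht
    have ht : 0 < t := ht
    have h := mul_measure_lt_maxFun_le_setLIntegral hfin hK hb (ENNReal.ofReal (t / 2))
    have hset : {z | ENNReal.ofReal (t / 2) + ENNReal.ofReal (t / 2) < maxFun μ b z} =
        {x | t < (maxFun μ b x).toReal} := by
      ext z
      rw [mem_ofPred_eq, mem_ofPred_eq, ← ENNReal.ofReal_add (by positivity) (by positivity),
        add_halves, ENNReal.ofReal_lt_iff_lt_toReal ht.le (hMtop z)]
    have hset2 : ∀ x, ENNReal.ofReal (t / 2) < b x ↔ t < 2 * (b x).toReal := fun x => by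
      rw [ENNReal.ofReal_lt_iff_lt_toReal (by positivity) (hbtop x)]
      constructor <;> intro <;> linarith
    rw [hset] at h
    have hpow : ENNReal.ofReal (t ^ (r - 1)) =
        2 * (ENNReal.ofReal (t / 2) * ENNReal.ofReal (t ^ ((r - 1) - 1))) := by
      rw [← ENNReal.ofReal_mul (by positivity), ← ENNReal.ofReal_ofNat 2,
        ← ENNReal.ofReal_mul (by positivity), Real.rpow_sub_one ht.ne' (r - 1)]
      congr 1
      field_simp
    calc μ {x | t < (maxFun μ b x).toReal} * ENNReal.ofReal (t ^ (r - 1))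
        = 2 * ENNReal.ofReal (t ^ ((r - 1) - 1)) *
          (ENNReal.ofReal (t / 2) * μ {x | t < (maxFun μ b x).toReal}) := by rw [hpow]; ring
      _ ≤ 2 * ENNReal.ofReal (t ^ ((r - 1) - 1)) *
          (K * ∫⁻ x in {x | ENNReal.ofReal (t / 2) < b x}, b x ∂μ) := by gcongr
      _ = 2 * K * (ENNReal.ofReal (t ^ ((r - 1) - 1)) *
          ∫⁻ x in {x | ENNReal.ofReal (t / 2) < b x}, b x ∂μ) := by ring
      _ = _ := by
        rw [← lintegral_const_mul _ hb,
          ← lintegral_indicator (measurableSet_lt measurable_const hb)]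
        congr 1
        refine lintegral_congr fun x => ?_
        by_cases hx : t < 2 * (b x).toReal
        · rw [indicator_of_mem (show x ∈ {x | ENNReal.ofReal (t / 2) < b x} from (hset2 x).2 hx),
            indicator_of_mem (show t ∈ Iio _ from hx), mul_comm]
        · rw [indicator_of_notMem (show x ∉ {x | ENNReal.ofReal (t / 2) < b x} from
            fun h => hx ((hset2 x).1 h)), indicator_of_notMem (show t ∉ Iio _ from hx), mul_zero]
  have hjoint : Measurable (Function.uncurry fun (t : ℝ) (x : X) =>
      b x * (Iio (2 * (b x).toReal)).indicator
        (fun t => ENNReal.ofReal (t ^ ((r - 1) - 1))) t) := by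
    refine (hb.comp measurable_snd).mul ?_
    have : (Function.uncurry fun (t : ℝ) (x : X) => (Iio (2 * (b x).toReal)).indicator
        (fun t => ENNReal.ofReal (t ^ ((r - 1) - 1))) t) =
        {p : ℝ × X | p.1 < 2 * (b p.2).toReal}.indicator
          (fun p => ENNReal.ofReal (p.1 ^ ((r - 1) - 1))) := by
      ext ⟨t, x⟩
      simp [Function.uncurry, indicator]
    change Measurable (Function.uncurry fun (t : ℝ) (x : X) => (Iio (2 * (b x).toReal)).indicator
        (fun t => ENNReal.ofReal (t ^ ((r - 1) - 1))) t)
    rw [this]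
    refine Measurable.indicator (by fun_prop) (measurableSet_lt measurable_fst ?_)
    exact ((hb.ennreal_toReal.comp measurable_snd).const_mul 2)
  calc ∫⁻ x, maxFun μ b x ^ r ∂μ = ∫⁻ x, ENNReal.ofReal ((maxFun μ b x).toReal ^ r) ∂μ := by
        refine lintegral_congr fun x => ?_
        rw [← ENNReal.ofReal_rpow_of_nonneg ENNReal.toReal_nonneg (by linarith),
          ENNReal.ofReal_toReal (hMtop x)]
    _ = ENNReal.ofReal r * ∫⁻ t in Ioi 0, μ {x | t < (maxFun μ b x).toReal} *
          ENNReal.ofReal (t ^ (r - 1)) :=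
        lintegral_rpow_eq_lintegral_meas_lt_mul μ (ae_of_all _ fun _ => ENNReal.toReal_nonneg)
          (measurable_maxFun μ b).ennreal_toReal.aemeasurable (by linarith)
    _ ≤ ENNReal.ofReal r * ∫⁻ t in Ioi (0 : ℝ), 2 * K * ∫⁻ x, b x *
          (Iio (2 * (b x).toReal)).indicator
            (fun t => ENNReal.ofReal (t ^ ((r - 1) - 1))) t ∂μ := by
        gcongr 1
        exact setLIntegral_mono' measurableSet_Ioi hpt
    _ = ENNReal.ofReal r * (2 * K * ∫⁻ x, ∫⁻ t in Ioi (0 : ℝ), b x *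
          (Iio (2 * (b x).toReal)).indicator
            (fun t => ENNReal.ofReal (t ^ ((r - 1) - 1))) t ∂volume ∂μ) := by
        rw [lintegral_const_mul _ hjoint.lintegral_prod_right, lintegral_lintegral_swap
          hjoint.aemeasurable]
    _ = ENNReal.ofReal r * (2 * K * ∫⁻ x, ENNReal.ofReal (2 ^ (r - 1) / (r - 1)) * b x ^ r ∂μ) := by
        congr 3
        ext x
        rw [lintegral_const_mul _ (by
          refine Measurable.indicator (by fun_prop) measurableSet_Iio),
          setLIntegral_indicator measurableSet_Iio, inter_comm, Ioi_inter_Iio,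
          lintegral_Ioo_rpow (by linarith) (by positivity)]
        obtain ⟨y, hy, hy'⟩ : ∃ y : ℝ, 0 ≤ y ∧ b x = ENNReal.ofReal y :=
          ⟨_, ENNReal.toReal_nonneg, (ENNReal.ofReal_toReal (hbtop x)).symm⟩
        rw [hy', ENNReal.toReal_ofReal hy, ENNReal.ofReal_rpow_of_nonneg hy (by linarith),
          ← ENNReal.ofReal_mul hy, ← ENNReal.ofReal_mul (by
            have : 0 < r - 1 := by linarith
            positivity), Real.mul_rpow (by norm_num) hy]
        congr 1
        rcases hy.eq_or_lt with rfl | hy0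
        · rw [Real.zero_rpow (by linarith : r ≠ 0)]; simp [Real.zero_rpow (by linarith : r - 1 ≠ 0)]
        · rw [Real.rpow_sub_one hy0.ne' r]
          field_simp
    _ = _ := by
        rw [lintegral_const_mul _ (hb.pow_const r)]
        have : ENNReal.ofReal (r * 2 ^ r / (r - 1)) =
            ENNReal.ofReal r * 2 * ENNReal.ofReal (2 ^ (r - 1) / (r - 1)) := by
          have h1 : 0 < r - 1 := by linarith
          rw [← ENNReal.ofReal_ofNat 2, ← ENNReal.ofReal_mul (by positivity),
            ← ENNReal.ofReal_mul (by positivity), Real.rpow_sub_one (by norm_num)]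
          congr 1
          field_simp
        rw [this]; ring

end Maximal

section Aperture

open scoped ENNReal

variable {X : Type*} [MetricSpace X] [MeasurableSpace X]

/-- The integral of `a` over the cone of aperture `γ` with vertex `x`. -/
def coneInt (ν : Measure (X × ℝ)) (a : X × ℝ → ℝ≥0∞) (γ : ℝ) (x : X) : ℝ≥0∞ :=
  ∫⁻ p, {p : X × ℝ | dist x p.1 < γ * p.2}.indicator a p ∂ν

variable [BorelSpace X]

lemma setLIntegral_ball_le_mul_maxFun {μ : Measure X} {D : ℝ≥0∞} {γ : ℝ} (hγ : 1 ≤ γ)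
    (hfin : ∀ x r, μ (ball x r) ≠ ∞)
    (hD : ∀ x r, μ (ball x (γ * r)) ≤ D * μ (ball x r)) (b : X → ℝ≥0∞) (y : X) (t : ℝ) :
    ∫⁻ x in ball y (γ * t), b x ∂μ ≤ D * ∫⁻ x in ball y (1 * t), maxFun μ b x ∂μ := by
  rw [one_mul]
  rcases le_or_gt t 0 with ht | ht
  · have : ball y (γ * t) = ∅ := ball_eq_empty.2 (mul_nonpos_of_nonneg_of_nonpos (by linarith) ht)
    simp [this]
  set A := (∫⁻ x in ball y (γ * t), b x ∂μ) / μ (ball y (γ * t)) with hA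
  calc ∫⁻ x in ball y (γ * t), b x ∂μ ≤ A * μ (ball y (γ * t)) := by
        by_cases h0 : μ (ball y (γ * t)) = 0
        · rw [setLIntegral_measure_zero _ _ h0]; exact zero_le
        · rw [hA, ENNReal.div_mul_cancel h0 (hfin _ _)]
    _ ≤ A * (D * μ (ball y t)) := by gcongr; exact hD y t
    _ = D * ∫⁻ _ in ball y t, A ∂μ := by rw [setLIntegral_const]; ring
    _ ≤ D * ∫⁻ x in ball y t, maxFun μ b x ∂μ := by
        refine mul_le_mul_right (setLIntegral_mono' measurableSet_ball fun x hx => ?_) _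
        exact le_maxFun μ b (ball_subset_ball (by nlinarith) hx)

variable [SecondCountableTopology X]

lemma measurable_cone_indicator {a : X × ℝ → ℝ≥0∞} (ha : Measurable a) (γ : ℝ) :
    Measurable (Function.uncurry fun (x : X) (p : X × ℝ) =>
      {p : X × ℝ | dist x p.1 < γ * p.2}.indicator a p) := by
  have : (Function.uncurry fun (x : X) (p : X × ℝ) =>
      {p : X × ℝ | dist x p.1 < γ * p.2}.indicator a p) =
      {q : X × (X × ℝ) | dist q.1 q.2.1 < γ * q.2.2}.indicator (fun q => a q.2) := by
    ext ⟨x, p⟩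
    simp [Function.uncurry, indicator]
  rw [this]
  exact (ha.comp measurable_snd).indicator (measurableSet_lt (by fun_prop) (by fun_prop))

lemma measurable_coneInt (ν : Measure (X × ℝ)) [SFinite ν] {a : X × ℝ → ℝ≥0∞} (ha : Measurable a)
    (γ : ℝ) : Measurable (coneInt ν a γ) :=
  (measurable_cone_indicator ha γ).lintegral_prod_right'

lemma lintegral_mul_coneInt (μ : Measure X) [SFinite μ] (ν : Measure (X × ℝ)) [SFinite ν]
    {a : X × ℝ → ℝ≥0∞} (ha : Measurable a) (γ : ℝ) {b : X → ℝ≥0∞} (hb : Measurable b) :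
    ∫⁻ x, b x * coneInt ν a γ x ∂μ = ∫⁻ p, a p * ∫⁻ x in ball p.1 (γ * p.2), b x ∂μ ∂ν := by
  have hm := measurable_cone_indicator ha γ
  calc ∫⁻ x, b x * coneInt ν a γ x ∂μ
      = ∫⁻ x, ∫⁻ p, b x * {p : X × ℝ | dist x p.1 < γ * p.2}.indicator a p ∂ν ∂μ := by
        refine lintegral_congr fun x => ?_
        exact (lintegral_const_mul _ (hm.comp measurable_prodMk_left)).symm
    _ = ∫⁻ p, ∫⁻ x, b x * {p : X × ℝ | dist x p.1 < γ * p.2}.indicator a p ∂μ ∂ν :=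
        lintegral_lintegral_swap ((hb.comp measurable_fst).mul hm).aemeasurable
    _ = _ := by
        refine lintegral_congr fun p => ?_
        rw [← lintegral_indicator measurableSet_ball,
          ← lintegral_const_mul _ (hb.indicator measurableSet_ball)]
        refine lintegral_congr fun x => ?_
        by_cases hx : dist x p.1 < γ * p.2 <;> simp [indicator, hx, mul_comm]

/-- Change of aperture in `L^p`, `p > 1`, for a doubling measure. -/
theorem lintegral_coneInt_rpow_le {μ : Measure X} [SigmaFinite μ] {ν : Measure (X × ℝ)} [SFinite ν]
    {K D : ℝ≥0∞} {γ p : ℝ} (hγ : 1 ≤ γ) (hp : 1 < p)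
    (hfin : ∀ x r, μ (ball x r) ≠ ∞)
    (hK : ∀ x r, μ (ball x (4 * r)) ≤ K * μ (ball x r))
    (hDtop : D ≠ ∞) (hD : ∀ x r, μ (ball x (γ * r)) ≤ D * μ (ball x r))
    {a : X × ℝ → ℝ≥0∞} (ha : Measurable a) :
    (∫⁻ x, coneInt ν a γ x ^ p ∂μ) ^ (1 / p) ≤
      D * (ENNReal.ofReal (p.conjExponent * 2 ^ p.conjExponent / (p.conjExponent - 1)) * K) ^
        (1 / p.conjExponent) * (∫⁻ x, coneInt ν a 1 x ^ p ∂μ) ^ (1 / p) := by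
  have hpq : p.HolderConjugate p.conjExponent := Real.HolderConjugate.conjExponent hp
  set p' := p.conjExponent
  set M := (ENNReal.ofReal (p' * 2 ^ p' / (p' - 1)) * K) ^ (1 / p') with hM
  set G := coneInt ν a γ
  have hG : Measurable G := measurable_coneInt ν ha γ
  have hG1 : Measurable (coneInt ν a 1) := measurable_coneInt ν ha 1
  set E : ℕ → X → ℝ≥0∞ := fun N => (spanningSets μ N).indicator fun x => min (G x) N
  have hEm : ∀ N, Measurable (E N) := fun N =>
    (hG.min measurable_const).indicator (measurableSet_spanningSets μ N)
  have hEN : ∀ N x, E N x ≤ N := fun N x => by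
    by_cases hx : x ∈ spanningSets μ N <;> simp [E, hx]
  have hEG : ∀ N x, E N x ≤ G x := fun N x => by
    by_cases hx : x ∈ spanningSets μ N <;> simp [E, hx]
  have hkey : ∀ N, (∫⁻ x, E N x ^ p ∂μ) ^ (1 / p) ≤
      D * M * (∫⁻ x, coneInt ν a 1 x ^ p ∂μ) ^ (1 / p) := by
    intro N
    set I := ∫⁻ x, E N x ^ p ∂μ with hI
    have hItop : I ≠ ∞ := by
      refine ne_top_of_le_ne_top (b := (N : ℝ≥0∞) ^ p * μ (spanningSets μ N)) ?_ ?_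
      · exact ENNReal.mul_ne_top (ENNReal.rpow_ne_top_of_nonneg hpq.nonneg (by simp))
          (measure_spanningSets_lt_top μ N).ne
      · rw [← setLIntegral_const, ← lintegral_indicator (measurableSet_spanningSets μ N)]
        refine lintegral_mono fun x => ?_
        by_cases hx : x ∈ spanningSets μ N
        · rw [indicator_of_mem hx]
          exact ENNReal.rpow_le_rpow (hEN N x) hpq.nonneg
        · simp [E, hx, hpq.pos]
    set b : X → ℝ≥0∞ := fun x => E N x ^ (p - 1) with hbdef
    have hb : Measurable b := (hEm N).pow_const _
    have hbp : ∫⁻ x, b x ^ p' ∂μ = I := by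
      refine lintegral_congr fun x => ?_
      rw [hbdef, ← ENNReal.rpow_mul, hpq.sub_one_mul_conj]
    have hmax := lintegral_maxFun_rpow_le hfin hK hpq.symm.lt hb
      (N := (N : ℝ≥0∞) ^ (p - 1)) (ENNReal.rpow_ne_top_of_nonneg hpq.sub_one_pos.le (by simp))
      (fun x => ENNReal.rpow_le_rpow (hEN N x) hpq.sub_one_pos.le)
    have hmain : I ≤ D * M * (∫⁻ x, coneInt ν a 1 x ^ p ∂μ) ^ (1 / p) * I ^ (1 / p') := by
      calc I ≤ ∫⁻ x, b x * G x ∂μ := by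
            refine lintegral_mono fun x => ?_
            have : E N x ^ p = E N x ^ (p - 1) * E N x := by
              have h := ENNReal.rpow_add_of_nonneg (x := E N x) _ _ hpq.sub_one_pos.le zero_le_one
              rwa [sub_add_cancel, ENNReal.rpow_one] at h
            rw [this]
            exact mul_le_mul_right (hEG N x) _
        _ = ∫⁻ p, a p * ∫⁻ x in ball p.1 (γ * p.2), b x ∂μ ∂ν :=
            lintegral_mul_coneInt μ ν ha γ hb
        _ ≤ ∫⁻ p, D * (a p * ∫⁻ x in ball p.1 (1 * p.2), maxFun μ b x ∂μ) ∂ν := by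
            refine lintegral_mono fun p => ?_
            rw [mul_left_comm]
            exact mul_le_mul_right (setLIntegral_ball_le_mul_maxFun hγ hfin hD b p.1 p.2) _
        _ ≤ D * ∫⁻ p, a p * ∫⁻ x in ball p.1 (1 * p.2), maxFun μ b x ∂μ ∂ν := by
            exact (lintegral_const_mul' _ _ hDtop).le
        _ = D * ∫⁻ x, (coneInt ν a 1 * maxFun μ b) x ∂μ := by
            rw [← lintegral_mul_coneInt μ ν ha 1 (measurable_maxFun μ b)]
            simp [mul_comm]
        _ ≤ D * ((∫⁻ x, coneInt ν a 1 x ^ p ∂μ) ^ (1 / p) *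
              (∫⁻ x, maxFun μ b x ^ p' ∂μ) ^ (1 / p')) := by
            gcongr
            exact ENNReal.lintegral_mul_le_Lp_mul_Lq μ hpq hG1.aemeasurable
              (measurable_maxFun μ b).aemeasurable
        _ ≤ D * ((∫⁻ x, coneInt ν a 1 x ^ p ∂μ) ^ (1 / p) * (M * I ^ (1 / p'))) := by
            gcongr
            rw [hM, ← ENNReal.mul_rpow_of_nonneg _ _ hpq.symm.one_div_nonneg, ← hbp]
            exact ENNReal.rpow_le_rpow hmax hpq.symm.one_div_nonneg
        _ = _ := by ring
    rcases eq_or_ne I 0 with h0 | h0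
    · rw [h0, ENNReal.zero_rpow_of_pos hpq.one_div_pos]
      exact zero_le
    · have h1 : I ^ (1 / p) * I ^ (1 / p') = I := by
        rw [← ENNReal.rpow_add _ _ h0 hItop, hpq.one_div_add_one_div, div_one, ENNReal.rpow_one]
      refine (ENNReal.mul_le_mul_iff_left (c := I ^ (1 / p')) ?_ ?_).1 ?_
      · exact (ENNReal.rpow_pos (pos_iff_ne_zero.2 h0) hItop).ne'
      · exact ENNReal.rpow_ne_top_of_nonneg hpq.symm.one_div_nonneg hItop
      · rw [h1]; exact hmain
  have hsup : ∀ x, ⨆ N, E N x ^ p = G x ^ p := by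
    intro x
    refine ((ENNReal.orderIsoRpow p hpq.pos).map_iSup (fun N => E N x)).symm.trans ?_
    refine congrArg (· ^ p) (le_antisymm (iSup_le fun N => hEG N x) ?_)
    refine le_of_forall_lt fun c hc => ?_
    obtain ⟨N₁, hN₁⟩ := ENNReal.exists_nat_gt (ne_top_of_lt hc)
    obtain ⟨N₂, hN₂⟩ := mem_iUnion.1 ((iUnion_spanningSets μ).symm ▸ mem_univ x)
    refine lt_iSup_iff.2 ⟨max N₁ N₂, ?_⟩
    have hx : x ∈ spanningSets μ (max N₁ N₂) := monotone_spanningSets μ (le_max_right _ _) hN₂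
    simp only [E, hx, indicator_of_mem]
    refine lt_min hc (hN₁.trans_le ?_)
    gcongr
    exact le_max_left _ _
  have hmono : Monotone fun N x => E N x ^ p := by
    intro N N' h x
    refine ENNReal.rpow_le_rpow ?_ hpq.nonneg
    by_cases hx : x ∈ spanningSets μ N
    · have hx' : x ∈ spanningSets μ N' := monotone_spanningSets μ h hx
      simp only [E, hx, hx', indicator_of_mem]
      gcongr
    · simp [E, hx]
  calc (∫⁻ x, G x ^ p ∂μ) ^ (1 / p) = (⨆ N, ∫⁻ x, E N x ^ p ∂μ) ^ (1 / p) := by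
        rw [← lintegral_iSup (fun N => (hEm N).pow_const _) hmono]
        simp_rw [hsup]
    _ = ⨆ N, (∫⁻ x, E N x ^ p ∂μ) ^ (1 / p) :=
        (ENNReal.orderIsoRpow (1 / p) hpq.one_div_pos).map_iSup _
    _ ≤ _ := iSup_le hkey

end Aperture

section IntrinsicAverage

variable {β : ℝ}

lemma MemCbeta.continuous (hβ : 0 < β) {φ : Rn n → ℝ} (hφ : MemCbeta β φ) : Continuous φ := by
  refine continuous_iff_continuousAt.2 fun x => ?_
  rw [ContinuousAt, tendsto_iff_norm_sub_tendsto_zero]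
  refine squeeze_zero (fun _ => norm_nonneg _) (fun y => hφ.2.2.2 y x) ?_
  have : Continuous fun y : Rn n => ‖y - x‖ ^ β :=
    (continuous_norm.comp (continuous_id.sub continuous_const)).rpow_const fun _ => Or.inr hβ.le
  simpa [Real.zero_rpow hβ.ne'] using this.tendsto x

lemma MemCbeta.abs_le (hβ : 0 < β) {φ : Rn n → ℝ} (hφ : MemCbeta β φ) (x : Rn n) :
    |φ x| ≤ 3 ^ β := by
  by_cases hx : φ x = 0
  · simp only [hx, abs_zero]; positivity
  have hx1 := hφ.1 x hx
  rcases Nat.eq_zero_or_pos n with rfl | hn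
  · exfalso
    have h0 := hφ.2.2.1
    have hc : φ = fun _ => φ x := funext fun y => congrArg φ (Subsingleton.elim y x)
    rw [hc, integral_const, smul_eq_mul, mul_eq_zero] at h0
    rcases h0 with h0 | h0
    · rw [Measure.real, ENNReal.toReal_eq_zero_iff] at h0
      rcases h0 with h0 | h0
      · exact NeZero.ne _ (Measure.measure_univ_eq_zero.1 h0)
      · have : (univ : Set (Rn 0)) = ball x 1 := by
          ext y; simp [Subsingleton.elim y x]
        rw [this] at h0
        exact measure_ball_lt_top.ne h0
    · exact hx h0
  · have : Nontrivial (Rn n) := by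
      have : Nonempty (Fin n) := ⟨⟨0, hn⟩⟩
      infer_instance
    obtain ⟨z, hz⟩ := exists_norm_eq (Rn n) (show (0 : ℝ) ≤ 2 by norm_num)
    have hz0 : φ z = 0 := by
      by_contra h
      have := hφ.1 z h
      linarith
    have h := hφ.2.2.2 x z
    rw [hz0, sub_zero] at h
    refine h.trans (Real.rpow_le_rpow (norm_nonneg _) ?_ hβ.le)
    linarith [norm_sub_le x z]

lemma MemCbeta.eq_zero_of_lt_dist {φ : Rn n → ℝ} (hφ : MemCbeta β φ) {t : ℝ} (ht : 0 < t)
    {x y : Rn n} (h : t < dist x y) : φ (t⁻¹ • (x - y)) = 0 := by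
  by_contra h0
  have := hφ.1 _ h0
  rw [norm_smul, norm_inv, Real.norm_of_nonneg ht.le, ← dist_eq_norm, inv_mul_le_iff₀ ht] at this
  linarith

lemma abs_convPhi_integrand_le (hβ : 0 < β) {φ : Rn n → ℝ} (hφ : MemCbeta β φ) (f : Rn n → ℝ)
    {t : ℝ} (ht : 0 < t) (x y : Rn n) :
    |f y * (t ^ (-(n : ℝ)) * φ (t⁻¹ • (x - y)))| ≤
      (closedBall x t).indicator (fun y => t ^ (-(n : ℝ)) * 3 ^ β * |f y|) y := by
  by_cases hy : y ∈ closedBall x t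
  · rw [indicator_of_mem hy, abs_mul, abs_mul, abs_of_nonneg (Real.rpow_nonneg ht.le _), mul_comm]
    gcongr
    exact hφ.abs_le hβ _
  · rw [indicator_of_notMem hy, hφ.eq_zero_of_lt_dist ht]
    · simp
    · rw [mem_closedBall, not_le, dist_comm] at hy; exact hy

lemma integrable_indicator_closedBall_abs {f : Rn n → ℝ} (hf : LocallyIntegrable f)
    (x : Rn n) (t : ℝ) (c : ℝ) :
    Integrable ((closedBall x t).indicator fun y => c * |f y|) := by
  rw [integrable_indicator_iff measurableSet_closedBall]
  exact ((hf.integrableOn_isCompact (isCompact_closedBall x t)).abs).const_mul c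

lemma aestronglyMeasurable_convPhi_integrand (hβ : 0 < β) {φ : Rn n → ℝ} (hφ : MemCbeta β φ)
    {f : Rn n → ℝ} (hf : LocallyIntegrable f) (t : ℝ) (x : Rn n) :
    AEStronglyMeasurable (fun y => f y * (t ^ (-(n : ℝ)) * φ (t⁻¹ • (x - y)))) volume := by
  refine hf.aestronglyMeasurable.mul (Continuous.aestronglyMeasurable ?_)
  exact continuous_const.mul ((hφ.continuous hβ).comp (by fun_prop))

lemma integrable_convPhi_integrand (hβ : 0 < β) {φ : Rn n → ℝ} (hφ : MemCbeta β φ)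
    {f : Rn n → ℝ} (hf : LocallyIntegrable f) {t : ℝ} (ht : 0 < t) (x : Rn n) :
    Integrable fun y => f y * (t ^ (-(n : ℝ)) * φ (t⁻¹ • (x - y))) := by
  refine (integrable_indicator_closedBall_abs hf x t (t ^ (-(n : ℝ)) * 3 ^ β)).mono'
    (aestronglyMeasurable_convPhi_integrand hβ hφ hf t x) (ae_of_all _ fun y => ?_)
  exact abs_convPhi_integrand_le hβ hφ f ht x y

lemma abs_convPhi_le (hβ : 0 < β) {φ : Rn n → ℝ} (hφ : MemCbeta β φ)
    {f : Rn n → ℝ} (hf : LocallyIntegrable f) {t : ℝ} (ht : 0 < t) (x : Rn n) :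
    |convPhi f φ t x| ≤ t ^ (-(n : ℝ)) * 3 ^ β * ∫ y in closedBall x t, |f y| := by
  rw [← integral_const_mul, ← integral_indicator measurableSet_closedBall]
  rw [← Real.norm_eq_abs, convPhi]
  refine norm_integral_le_of_norm_le
    (integrable_indicator_closedBall_abs hf x t (t ^ (-(n : ℝ)) * 3 ^ β)) (ae_of_all _ fun y => ?_)
  exact abs_convPhi_integrand_le hβ hφ f ht x y

lemma bddAbove_range_convPhi (hβ : 0 < β) {f : Rn n → ℝ} (hf : LocallyIntegrable f) {t : ℝ}
    (ht : 0 < t) (x : Rn n) :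
    BddAbove (range fun φ : {φ : Rn n → ℝ // MemCbeta β φ} => |convPhi f φ.1 t x|) := by
  refine ⟨t ^ (-(n : ℝ)) * 3 ^ β * ∫ y in closedBall x t, |f y|, ?_⟩
  rintro _ ⟨φ, rfl⟩
  exact abs_convPhi_le hβ φ.2 hf ht x

lemma memCbeta_zero : MemCbeta β (0 : Rn n → ℝ) := by
  refine ⟨fun x h => absurd rfl h, integrable_zero _ _ _, by simp, fun x x' => ?_⟩
  simp only [Pi.zero_apply, sub_zero, abs_zero]
  positivity

lemma Abeta_nonneg (f : Rn n → ℝ) (x : Rn n) (t : ℝ) : 0 ≤ Abeta β f x t :=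
  Real.iSup_nonneg fun _ => abs_nonneg _

lemma abs_convPhi_le_Abeta (hβ : 0 < β) {φ : Rn n → ℝ} (hφ : MemCbeta β φ)
    {f : Rn n → ℝ} (hf : LocallyIntegrable f) {t : ℝ} (ht : 0 < t) (x : Rn n) :
    |convPhi f φ t x| ≤ Abeta β f x t :=
  le_ciSup (bddAbove_range_convPhi hβ hf ht x) ⟨φ, hφ⟩

lemma Abeta_le {f : Rn n → ℝ} {t : ℝ} {x : Rn n} {c : ℝ}
    (h : ∀ φ : Rn n → ℝ, MemCbeta β φ → |convPhi f φ t x| ≤ c) : Abeta β f x t ≤ c := by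
  have : Nonempty {φ : Rn n → ℝ // MemCbeta β φ} := ⟨⟨0, memCbeta_zero⟩⟩
  exact ciSup_le fun φ => h φ.1 φ.2

lemma Abeta_add_le (hβ : 0 < β) {f g : Rn n → ℝ} (hf : LocallyIntegrable f)
    (hg : LocallyIntegrable g) {t : ℝ} (ht : 0 < t) (x : Rn n) :
    Abeta β (fun y => f y + g y) x t ≤ Abeta β f x t + Abeta β g x t := by
  refine Abeta_le fun φ hφ => ?_
  have : convPhi (fun y => f y + g y) φ t x = convPhi f φ t x + convPhi g φ t x := by
    simp only [convPhi, add_mul]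
    exact integral_add (integrable_convPhi_integrand hβ hφ hf ht x)
      (integrable_convPhi_integrand hβ hφ hg ht x)
  rw [this]
  exact (abs_add_le _ _).trans (add_le_add (abs_convPhi_le_Abeta hβ hφ hf ht x)
    (abs_convPhi_le_Abeta hβ hφ hg ht x))

lemma Abeta_congr {f g : Rn n → ℝ} {t : ℝ} (ht : 0 < t) {x : Rn n}
    (h : ∀ y ∈ closedBall x t, f y = g y) : Abeta β f x t = Abeta β g x t := by
  unfold Abeta
  congr 1
  ext φ
  congr 1
  refine integral_congr_ae (ae_of_all _ fun y => ?_)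
  by_cases hy : y ∈ closedBall x t
  · simp only [h y hy]
  · have : φ.1 (t⁻¹ • (x - y)) = 0 := φ.2.eq_zero_of_lt_dist ht (by
      rw [mem_closedBall, not_le, dist_comm] at hy; exact hy)
    simp [this]

lemma continuousAt_convPhi (hβ : 0 < β) {φ : Rn n → ℝ} (hφ : MemCbeta β φ)
    {f : Rn n → ℝ} (hf : LocallyIntegrable f) {p : Rn n × ℝ} (hp : 0 < p.2) :
    ContinuousAt (fun q : Rn n × ℝ => convPhi f φ q.2 q.1) p := by
  obtain ⟨x₀, t₀⟩ := p
  simp only at hp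
  have h1 : ∀ᶠ q : Rn n × ℝ in nhds (x₀, t₀), q.1 ∈ ball x₀ 1 ∧ q.2 ∈ Ioo (t₀ / 2) (2 * t₀) := by
    refine (prod_mem_nhds (ball_mem_nhds x₀ one_pos)
      (Ioo_mem_nhds (by linarith : t₀ / 2 < t₀) (by linarith)))
  refine continuousAt_of_dominated (bound := (closedBall x₀ (2 * t₀ + 1)).indicator
    fun y => ((t₀ / 2) ^ (-(n : ℝ)) * 3 ^ β) * |f y|) ?_ ?_ ?_ ?_
  · exact Filter.Eventually.of_forall fun q => aestronglyMeasurable_convPhi_integrand hβ hφ hf _ _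
  · filter_upwards [h1] with q hq
    refine ae_of_all _ fun y => ?_
    have hq2 : 0 < q.2 := by linarith [hq.2.1]
    refine (abs_convPhi_integrand_le hβ hφ f hq2 q.1 y).trans ?_
    have hsub : closedBall q.1 q.2 ⊆ closedBall x₀ (2 * t₀ + 1) :=
      closedBall_subset_closedBall' (by linarith [hq.2.2, mem_ball.1 hq.1])
    refine (indicator_le_indicator_of_subset hsub (fun y => by positivity) y).trans
      (indicator_le_indicator ?_)
    have := Real.rpow_le_rpow_of_nonpos (by linarith : 0 < t₀ / 2) hq.2.1.le
      (by simp : -(n : ℝ) ≤ 0)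
    gcongr
  · exact integrable_indicator_closedBall_abs hf _ _ _
  · refine ae_of_all _ fun y => ?_
    have hφc := hφ.continuous hβ
    refine continuousAt_const.mul (ContinuousAt.mul ?_ ?_)
    · exact continuousAt_snd.rpow_const (Or.inl hp.ne')
    · refine hφc.continuousAt.comp ?_
      exact (continuousAt_snd.inv₀ hp.ne').smul (continuousAt_fst.sub continuousAt_const)

/-- `A_β(f)` extended by zero from the upper half-space is Borel measurable. -/
lemma measurable_indicator_Abeta (hβ : 0 < β) {f : Rn n → ℝ} (hf : LocallyIntegrable f) :
    Measurable ({p : Rn n × ℝ | 0 < p.2}.indicator fun p => Abeta β f p.1 p.2) := by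
  refine measurable_of_Ioi fun c => ?_
  rcases lt_or_ge c 0 with hc | hc
  · convert MeasurableSet.univ
    refine eq_univ_of_forall fun p => ?_
    exact hc.trans_le (indicator_nonneg (fun p _ => Abeta_nonneg f p.1 p.2) p)
  · refine IsOpen.measurableSet (isOpen_iff_mem_nhds.2 fun p hp => ?_)
    have hp' : c < {p : Rn n × ℝ | 0 < p.2}.indicator (fun p => Abeta β f p.1 p.2) p := hp
    have hp2 : 0 < p.2 := by
      by_contra h
      rw [indicator_of_notMem (by exact h)] at hp'
      linarith
    rw [indicator_of_mem (by exact hp2)] at hp'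
    have : Nonempty {φ : Rn n → ℝ // MemCbeta β φ} := ⟨⟨0, memCbeta_zero⟩⟩
    obtain ⟨φ, hφ⟩ := exists_lt_of_lt_ciSup hp'
    have hcont := (continuousAt_convPhi hβ φ.2 hf hp2).abs
    filter_upwards [hcont.eventually (lt_mem_nhds hφ),
      continuousAt_snd.eventually (lt_mem_nhds hp2)] with q hq hq2
    change c < _
    rw [indicator_of_mem (by exact hq2)]
    exact hq.trans_le (abs_convPhi_le_Abeta hβ φ.2 hf hq2 q.1)

lemma measurable_Abeta_left (hβ : 0 < β) {f : Rn n → ℝ} (hf : LocallyIntegrable f) {t : ℝ}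
    (ht : 0 < t) : Measurable fun x => Abeta β f x t := by
  have := (measurable_indicator_Abeta hβ hf).comp (measurable_prodMk_right (y := t))
  convert this using 2 with x
  simp [ht]

/-- Comparison of `A_β(f)` at two points of the upper half-space. -/
lemma Abeta_le_mul_Abeta (hβ : 0 < β) {f : Rn n → ℝ} (hf : LocallyIntegrable f) {t s : ℝ}
    (ht : 0 < t) {y y' : Rn n} (h : dist y y' + t ≤ s) :
    Abeta β f y t ≤ (s / t) ^ ((n : ℝ) + β) * Abeta β f y' s := by
  have hs : 0 < s := by linarith [dist_nonneg (x := y) (y := y')]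
  refine Abeta_le fun φ hφ => ?_
  set ψ : Rn n → ℝ := fun u => (t / s) ^ β * φ ((s / t) • u + t⁻¹ • (y - y')) with hψ
  have hst : s / t ≠ 0 := by positivity
  have hψm : MemCbeta β ψ := by
    refine ⟨fun u hu => ?_, ?_, ?_, fun u u' => ?_⟩
    · have h1 := hφ.1 _ (right_ne_zero_of_mul hu)
      have h2 : ‖(s / t) • u‖ ≤ 1 + ‖t⁻¹ • (y - y')‖ := by
        have := norm_sub_le ((s / t) • u + t⁻¹ • (y - y')) (t⁻¹ • (y - y'))
        rw [add_sub_cancel_right] at this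
        linarith
      rw [norm_smul, norm_smul, Real.norm_of_nonneg (by positivity),
        Real.norm_of_nonneg (by positivity), ← dist_eq_norm] at h2
      have h3 : s * ‖u‖ ≤ s * 1 := by
        have := mul_le_mul_of_nonneg_left h2 ht.le
        field_simp at this
        linarith
      exact le_of_mul_le_mul_left h3 hs
    · exact (((hφ.2.1.comp_add_right (t⁻¹ • (y - y'))).comp_smul hst)).const_mul _
    · rw [integral_const_mul, Measure.integral_comp_smul volume
        (fun z => φ (z + t⁻¹ • (y - y'))), integral_add_right_eq_self φ, hφ.2.2.1]
      simp
    · rw [hψ]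
      simp only
      rw [← mul_sub, abs_mul, abs_of_nonneg (by positivity)]
      have h1 := hφ.2.2.2 ((s / t) • u + t⁻¹ • (y - y')) ((s / t) • u' + t⁻¹ • (y - y'))
      rw [add_sub_add_right_eq_sub, ← smul_sub, norm_smul, Real.norm_of_nonneg (by positivity),
        Real.mul_rpow (by positivity) (norm_nonneg _)] at h1
      calc (t / s) ^ β * _ ≤ (t / s) ^ β * ((s / t) ^ β * ‖u - u'‖ ^ β) := by gcongr
        _ = ‖u - u'‖ ^ β := by
          rw [← mul_assoc, ← Real.mul_rpow (by positivity) (by positivity)]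
          have : t / s * (s / t) = 1 := by field_simp
          rw [this, Real.one_rpow, one_mul]
  have hconv : convPhi f φ t y = (s / t) ^ ((n : ℝ) + β) * convPhi f ψ s y' := by
    rw [convPhi, convPhi, ← integral_const_mul]
    congr 1
    ext z
    have harg : (s / t) • (s⁻¹ • (y' - z)) + t⁻¹ • (y - y') = t⁻¹ • (y - z) := by
      rw [smul_smul]
      have : s / t * s⁻¹ = t⁻¹ := by field_simp
      rw [this, ← smul_add]
      congr 1
      abel
    rw [hψ]
    simp only [harg]
    have hc : t ^ (-(n : ℝ)) = (s / t) ^ ((n : ℝ) + β) * (s ^ (-(n : ℝ)) * (t / s) ^ β) := by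
      rw [Real.rpow_add (by positivity), Real.div_rpow hs.le ht.le, Real.div_rpow hs.le ht.le,
        Real.div_rpow ht.le hs.le, Real.rpow_neg ht.le, Real.rpow_neg hs.le]
      have h1 := Real.rpow_pos_of_pos hs (n : ℝ)
      have h2 := Real.rpow_pos_of_pos ht (n : ℝ)
      have h3 := Real.rpow_pos_of_pos hs β
      have h4 := Real.rpow_pos_of_pos ht β
      field_simp
    rw [hc]; ring
  rw [hconv, abs_mul, abs_of_nonneg (by positivity)]
  gcongr
  exact abs_convPhi_le_Abeta hβ hψm hf hs y'

end IntrinsicAverage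

section Net

/-- A metric space contains nets at every scale, with disjoint balls. -/
lemma exists_disjoint_net (X : Type*) [MetricSpace X] {t : ℝ} (ht : 0 < t) :
    ∃ N : Set X, N.PairwiseDisjoint (fun x => ball x t) ∧ ∀ x, ∃ y ∈ N, dist x y ≤ 5 * t := by
  obtain ⟨u, -, hu, hcov⟩ := Vitali.exists_disjoint_subfamily_covering_enlargement_closedBall
    (univ : Set X) id (fun _ => t) t (fun _ _ => le_rfl) 5 (by norm_num)
  refine ⟨u, hu.mono_on fun x _ => ball_subset_closedBall, fun x => ?_⟩
  obtain ⟨y, hy, hxy⟩ := hcov x (mem_univ x)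
  exact ⟨y, hy, hxy (mem_closedBall_self ht.le)⟩

/-- An upper bound of Selberg type for the coefficients of a vector against a finite family. -/
lemma sum_inner_sq_div_le {E ι : Type*} [NormedAddCommGroup E] [InnerProductSpace ℝ E]
    (s : Finset ι) (v : ι → E) (c : ι → ℝ) (hc : ∀ i ∈ s, 0 < c i)
    (h : ∀ i ∈ s, ∑ j ∈ s, |inner ℝ (v i) (v j)| ≤ c i) (f : E) :
    ∑ i ∈ s, inner ℝ f (v i) ^ 2 / c i ≤ ‖f‖ ^ 2 := by
  set a : ι → ℝ := fun i => inner ℝ f (v i) / c i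
  have h0 : 0 ≤ ‖f - ∑ i ∈ s, a i • v i‖ ^ 2 := by positivity
  rw [norm_sub_sq_real, inner_sum] at h0
  have h1 : ∑ i ∈ s, inner ℝ f (a i • v i) = ∑ i ∈ s, inner ℝ f (v i) ^ 2 / c i := by
    refine Finset.sum_congr rfl fun i _ => ?_
    rw [inner_smul_right]; simp only [a]; ring
  have h2 : ‖∑ i ∈ s, a i • v i‖ ^ 2 ≤ ∑ i ∈ s, inner ℝ f (v i) ^ 2 / c i := by
    rw [← real_inner_self_eq_norm_sq, sum_inner]
    simp only [inner_sum, inner_smul_left, inner_smul_right, RCLike.conj_to_real]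
    have hS : ∑ i ∈ s, ∑ j ∈ s, a j * (a i * inner ℝ (v i) (v j)) ≤
        ∑ i ∈ s, ∑ j ∈ s, (a i ^ 2 / 2 * |inner ℝ (v i) (v j)| +
          a j ^ 2 / 2 * |inner ℝ (v j) (v i)|) := by
      refine Finset.sum_le_sum fun i _ => Finset.sum_le_sum fun j _ => ?_
      rw [real_inner_comm (v i) (v j), ← add_mul, ← mul_assoc, mul_comm (a j)]
      refine (le_abs_self _).trans ?_
      rw [abs_mul]
      gcongr
      rw [abs_mul]
      nlinarith [sq_nonneg (|a i| - |a j|), sq_abs (a i), sq_abs (a j)]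
    refine hS.trans ?_
    simp only [Finset.sum_add_distrib]
    rw [Finset.sum_comm (f := fun i j => a j ^ 2 / 2 * |inner ℝ (v j) (v i)|), ← two_mul]
    simp only [← Finset.mul_sum]
    rw [Finset.mul_sum]
    refine Finset.sum_le_sum fun i hi => ?_
    have := h i hi
    have hci := hc i hi
    calc 2 * (a i ^ 2 / 2 * ∑ j ∈ s, |inner ℝ (v i) (v j)|)
        ≤ 2 * (a i ^ 2 / 2 * c i) := by gcongr
      _ = _ := by simp only [a]; field_simp
  rw [h1] at h0
  linarith

end Net

section SquareFunctionL2

open scoped ENNReal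

variable {β : ℝ}

/-- The volume of the unit ball of `ℝⁿ`. -/
def unitVol (n : ℕ) : ℝ := (volume (ball (0 : Rn n) 1)).toReal

lemma unitVol_pos : 0 < unitVol n :=
  ENNReal.toReal_pos (measure_ball_pos _ _ one_pos).ne' measure_ball_lt_top.ne

lemma volume_ball_Rn (x : Rn n) {r : ℝ} (hr : 0 < r) :
    volume (ball x r) = ENNReal.ofReal (r ^ n * unitVol n) := by
  rw [Measure.addHaar_ball_of_pos _ _ hr, finrank_euclideanSpace_fin,
    ENNReal.ofReal_mul (by positivity), unitVol, ENNReal.ofReal_toReal measure_ball_lt_top.ne]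

lemma volume_closedBall_Rn (x : Rn n) {r : ℝ} (hr : 0 < r) :
    volume (closedBall x r) = ENNReal.ofReal (r ^ n * unitVol n) := by
  rw [Measure.addHaar_closedBall _ _ hr.le, finrank_euclideanSpace_fin,
    ENNReal.ofReal_mul (by positivity), unitVol, ENNReal.ofReal_toReal measure_ball_lt_top.ne]

lemma volume_real_closedBall_Rn (x : Rn n) {r : ℝ} (hr : 0 < r) :
    volume.real (closedBall x r) = r ^ n * unitVol n := by
  rw [Measure.real, volume_closedBall_Rn x hr, ENNReal.toReal_ofReal]
  have := unitVol_pos (n := n)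
  positivity

/-- The kernel `y ↦ φ_t(x - y)`. -/
def dilate (φ : Rn n → ℝ) (t : ℝ) (x y : Rn n) : ℝ := t ^ (-(n : ℝ)) * φ (t⁻¹ • (x - y))

lemma MemCbeta.integral_dilate {φ : Rn n → ℝ} (hφ : MemCbeta β φ) (t : ℝ) (x : Rn n) :
    ∫ y, dilate φ t x y = 0 := by
  simp only [dilate]
  rw [integral_const_mul, integral_sub_left_eq_self (fun z => φ (t⁻¹ • z)),
    Measure.integral_comp_smul, hφ.2.2.1]
  simp

lemma MemCbeta.continuous_dilate (hβ : 0 < β) {φ : Rn n → ℝ} (hφ : MemCbeta β φ) (t : ℝ)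
    (x : Rn n) : Continuous (dilate φ t x) :=
  continuous_const.mul ((hφ.continuous hβ).comp (by fun_prop))

lemma MemCbeta.hasCompactSupport_dilate {φ : Rn n → ℝ} (hφ : MemCbeta β φ) {t : ℝ} (ht : 0 < t)
    (x : Rn n) : HasCompactSupport (dilate φ t x) := by
  refine HasCompactSupport.of_support_subset_isCompact (isCompact_closedBall x t) fun y hy => ?_
  by_contra h
  rw [mem_closedBall, not_le, dist_comm] at h
  exact hy (by simp [dilate, hφ.eq_zero_of_lt_dist ht h])

lemma MemCbeta.abs_dilate_sub_le {φ : Rn n → ℝ} (hφ : MemCbeta β φ) {t : ℝ} (ht : 0 < t)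
    (x y y' : Rn n) :
    |dilate φ t x y - dilate φ t x y'| ≤ t ^ (-(n : ℝ)) * (dist y y' / t) ^ β := by
  rw [dilate, dilate, ← mul_sub, abs_mul, abs_of_nonneg (by positivity)]
  gcongr
  refine (hφ.2.2.2 (t⁻¹ • (x - y)) (t⁻¹ • (x - y'))).trans_eq ?_
  congr 1
  rw [← smul_sub, norm_smul, Real.norm_of_nonneg (by positivity), sub_sub_sub_cancel_left,
    dist_comm, dist_eq_norm, inv_mul_eq_div]

/-- `A_β(f)` is controlled by the oscillation of `f`. -/
lemma Abeta_le_of_abs_sub_le (hβ : 0 < β) {f : Rn n → ℝ} (hf : LocallyIntegrable f) {t : ℝ}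
    (ht : 0 < t) {x : Rn n} {c δ : ℝ} (h : ∀ y ∈ closedBall x t, |f y - c| ≤ δ) :
    Abeta β f x t ≤ 3 ^ β * unitVol n * δ := by
  refine Abeta_le fun φ hφ => ?_
  have hc : LocallyIntegrable (fun _ : Rn n => c) := continuous_const.locallyIntegrable
  have h1 : convPhi f φ t x = convPhi (fun y => f y - c) φ t x := by
    have := integral_sub (integrable_convPhi_integrand hβ hφ hf ht x)
      (integrable_convPhi_integrand hβ hφ hc ht x)
    simp only [← sub_mul] at this
    rw [convPhi, convPhi, this, integral_const_mul]
    have h0 := hφ.integral_dilate t x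
    simp only [dilate] at h0
    rw [h0]; ring
  rw [h1]
  refine (abs_convPhi_le hβ hφ (hf.sub hc) ht x).trans ?_
  have h2 : ∫ y in closedBall x t, |f y - c| ≤ t ^ n * unitVol n * δ := by
    rw [← volume_real_closedBall_Rn x ht, mul_comm]
    refine (le_abs_self _).trans ?_
    rw [← Real.norm_eq_abs]
    refine norm_setIntegral_le_of_norm_le_const measure_closedBall_lt_top fun y hy => ?_
    simpa using h y hy
  calc t ^ (-(n : ℝ)) * 3 ^ β * ∫ y in closedBall x t, |f y - c|
      ≤ t ^ (-(n : ℝ)) * 3 ^ β * (t ^ n * unitVol n * δ) := by gcongr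
    _ = _ := by
      rw [Real.rpow_neg ht.le, Real.rpow_natCast]
      field_simp

/-- Almost orthogonality of the kernels `φ_t(x - ·)`. -/
lemma abs_integral_dilate_mul_le (hβ : 0 < β) {φ ψ : Rn n → ℝ} (hφ : MemCbeta β φ)
    (hψ : MemCbeta β ψ) {s r : ℝ} (hs : 0 < s) (hr : 0 < r) (x y : Rn n) :
    |∫ z, dilate ψ r y z * dilate φ s x z| ≤
      3 ^ β * unitVol n * (r ^ (-(n : ℝ)) * (s / r) ^ β) := by
  have hloc := (hψ.continuous_dilate hβ r y).locallyIntegrable (μ := volume)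
  refine (abs_convPhi_le_Abeta hβ hφ hloc hs x).trans
    (Abeta_le_of_abs_sub_le hβ hloc hs (c := dilate ψ r y x) fun z hz => ?_)
  refine (hψ.abs_dilate_sub_le hr y z x).trans ?_
  gcongr
  exact hz

lemma integral_dilate_mul_eq_zero {φ ψ : Rn n → ℝ} (hφ : MemCbeta β φ)
    (hψ : MemCbeta β ψ) {s r : ℝ} (hs : 0 < s) (hr : 0 < r) {x y : Rn n} (h : s + r < dist x y) :
    ∫ z, dilate ψ r y z * dilate φ s x z = 0 := by
  have : ∀ z, dilate ψ r y z * dilate φ s x z = 0 := fun z => by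
    rcases lt_or_ge s (dist x z) with h1 | h1
    · simp [dilate, hφ.eq_zero_of_lt_dist hs h1]
    · have : r < dist y z := by linarith [dist_triangle_right x y z]
      simp [dilate, hψ.eq_zero_of_lt_dist hr this]
  simp [this]

end SquareFunctionL2

section AlmostOrthogonality

open scoped ENNReal

variable {β : ℝ}

lemma abs_integral_dilate_mul_le_ite (hβ : 0 < β) {φ ψ : Rn n → ℝ} (hφ : MemCbeta β φ)
    (hψ : MemCbeta β ψ) {s r : ℝ} (hs : 0 < s) (hr : 0 < r) (x y : Rn n) :
    |∫ z, dilate φ s x z * dilate ψ r y z| ≤ if dist x y ≤ 2 * max s r then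
      3 ^ β * unitVol n * (max s r ^ (-(n : ℝ)) * (min s r / max s r) ^ β) else 0 := by
  split_ifs with h
  · rcases le_total s r with hsr | hsr
    · rw [max_eq_right hsr, min_eq_left hsr]
      simp only [mul_comm (dilate φ s x _)]
      exact abs_integral_dilate_mul_le hβ hφ hψ hs hr x y
    · rw [max_eq_left hsr, min_eq_right hsr]
      exact abs_integral_dilate_mul_le hβ hψ hφ hr hs y x
  · simp only [mul_comm (dilate φ s x _)]
    rw [integral_dilate_mul_eq_zero hφ hψ hs hr, abs_zero]
    linarith [le_max_left s r, le_max_right s r]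

lemma tsum_net_le {N : Set (Rn n)} {t R : ℝ} (hN : N.PairwiseDisjoint fun x => ball x t)
    (ht : 0 < t) (htR : t ≤ R) (x : Rn n) :
    ∑' y : N, (if dist x y ≤ 2 * R then ENNReal.ofReal (t ^ n) else 0) ≤
      ENNReal.ofReal ((3 * R) ^ n) := by
  have hv := unitVol_pos (n := n)
  have hcount : N.Countable := hN.countable_of_isOpen (fun _ _ => isOpen_ball)
    fun y _ => ⟨y, mem_ball_self ht⟩
  have : Countable N := hcount.to_subtype
  set E : N → Set (Rn n) := fun y => if dist x y ≤ 2 * R then ball y t else ∅ with hE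
  have hEm : ∀ y, MeasurableSet (E y) := fun y => by
    simp only [hE]; split_ifs
    · exact measurableSet_ball
    · exact MeasurableSet.empty
  have hEd : Pairwise (Function.onFun Disjoint E) := fun y z hyz => by
    have := hN y.2 z.2 (Subtype.coe_injective.ne hyz)
    simp only [Function.onFun, hE] at this ⊢
    split_ifs <;> simp [this]
  have hvol : volume (⋃ y, E y) ≤ volume (ball x (3 * R)) := by
    refine measure_mono (iUnion_subset fun y => ?_)
    simp only [hE]; split_ifs with h
    · refine ball_subset_ball' ?_
      rw [dist_comm]; linarith
    · exact empty_subset _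
  have hR : 0 < R := ht.trans_le htR
  rw [measure_iUnion hEd hEm, volume_ball_Rn x (by linarith), ENNReal.ofReal_mul (by positivity)]
    at hvol
  have hEv : ∀ y, volume (E y) =
      (if dist x y ≤ 2 * R then ENNReal.ofReal (t ^ n) else 0) * ENNReal.ofReal (unitVol n) := by
    intro y
    simp only [hE]; split_ifs with h
    · rw [volume_ball_Rn _ ht, ENNReal.ofReal_mul (by positivity)]
    · simp
  simp only [hEv, ENNReal.tsum_mul_right] at hvol
  exact (ENNReal.mul_le_mul_iff_left (by simpa using hv) ENNReal.ofReal_ne_top).1 hvol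

lemma tsum_pow_dist_le {θ : ℝ≥0∞} (hθ : θ ≤ 1) (k : ℕ) :
    ∑' l : ℕ, θ ^ (Nat.dist k l) ≤ 2 * (1 - θ)⁻¹ := by
  rw [← ENNReal.summable.sum_add_tsum_nat_add' (k := k), two_mul, ← ENNReal.tsum_geometric]
  refine add_le_add ?_ (le_of_eq ?_)
  · rw [← Finset.sum_range_reflect]
    refine le_trans (Finset.sum_le_sum fun i hi => ?_) (ENNReal.sum_le_tsum (Finset.range k))
    refine pow_le_pow_right_of_le_one' hθ ?_
    have := Finset.mem_range.1 hi
    rw [Nat.dist]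
    omega
  · refine tsum_congr fun l => ?_
    congr 1
    simp [Nat.dist]

/-- The Bessel type inequality for a finite family of kernels attached to dyadic nets. -/
lemma exists_bessel_dilate (n : ℕ) (hβ : 0 < β) : ∃ M : ℝ, 0 < M ∧
    ∀ (r₀ : ℝ), 0 < r₀ → ∀ (N : ℕ → Set (Rn n)),
    (∀ k, (N k).PairwiseDisjoint fun x => ball x (r₀ / 2 ^ k)) →
    ∀ φ : (Σ k, N k) → Rn n → ℝ, (∀ i, MemCbeta β (φ i)) →
    ∀ (S : Finset (Σ k, N k)) (f : Rn n → ℝ), MemLp f 2 volume →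
    ∑ i ∈ S, (r₀ / 2 ^ i.1) ^ n * convPhi f (φ i) (6 * (r₀ / 2 ^ i.1)) i.2 ^ 2 ≤
      M * ∫ x, f x ^ 2 := by
  set θ : ℝ := (1 / 2) ^ β with hθ
  have hθ0 : 0 < θ := by positivity
  have hθ1 : θ < 1 := Real.rpow_lt_one (by norm_num) (by norm_num) hβ
  have hv := unitVol_pos (n := n)
  refine ⟨3 ^ β * unitVol n * 3 ^ n * (2 * (1 - θ)⁻¹), ?_, ?_⟩
  · have : 0 < 1 - θ := by linarith
    positivity
  intro r₀ hr₀ N hN φ hφ S f hf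
  set M : ℝ := 3 ^ β * unitVol n * 3 ^ n * (2 * (1 - θ)⁻¹) with hM
  have hMpos : 0 < M := by
    have : 0 < 1 - θ := by linarith
    positivity
  set t : ℕ → ℝ := fun k => r₀ / 2 ^ k with ht
  have htpos : ∀ k, 0 < t k := fun k => by positivity
  have hmem : ∀ i : Σ k, N k, MemLp (dilate (φ i) (6 * t i.1) i.2) 2 volume := fun i =>
    ((hφ i).continuous_dilate hβ _ _).memLp_of_hasCompactSupport
      ((hφ i).hasCompactSupport_dilate (by have := htpos i.1; positivity) _)
  have hinner : ∀ {g h : Rn n → ℝ} (hg : MemLp g 2 volume) (hh : MemLp h 2 volume),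
      inner ℝ (hg.toLp g) (hh.toLp h) = ∫ x, g x * h x := by
    intro g h hg hh
    rw [L2.inner_def]
    refine integral_congr_ae ?_
    filter_upwards [hg.coeFn_toLp, hh.coeFn_toLp] with x h1 h2
    rw [h1, h2]
    simp [mul_comm]
  have hratio : ∀ k l, min (6 * t k) (6 * t l) / max (6 * t k) (6 * t l) =
      (1 / 2) ^ Nat.dist k l := by
    have h1 : ∀ k l, k ≤ l → t l / t k = (1 / 2) ^ Nat.dist k l := fun k l hkl => by
      rw [Nat.dist_eq_sub_of_le hkl, ht, one_div, inv_pow, pow_sub₀ _ two_ne_zero hkl]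
      simp only
      field_simp
    have h2 : ∀ k l, k ≤ l → t l ≤ t k := fun k l hkl => by
      simp only [ht]
      gcongr
      norm_num
    intro k l
    rw [← mul_max_of_nonneg _ _ (by norm_num : (0 : ℝ) ≤ 6),
      ← mul_min_of_nonneg _ _ (by norm_num : (0 : ℝ) ≤ 6), mul_div_mul_left _ _ (by norm_num)]
    rcases le_total k l with h | h
    · rw [max_eq_left (h2 k l h), min_eq_right (h2 k l h), h1 k l h]
    · rw [max_eq_right (h2 l k h), min_eq_left (h2 l k h), h1 l k h, Nat.dist_comm]
  have key : ∀ i ∈ S, ∑ j ∈ S, |∫ z, dilate (φ i) (6 * t i.1) i.2 z *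
      dilate (φ j) (6 * t j.1) j.2 z| * t j.1 ^ n ≤ M := by
    intro i _
    have hR : ∀ l, 0 < 6 * max (t i.1) (t l) := fun l => by
      have := (htpos i.1).trans_le (le_max_left (t i.1) (t l))
      positivity
    have hterm : ∀ j : Σ k, N k, |∫ z, dilate (φ i) (6 * t i.1) i.2 z *
        dilate (φ j) (6 * t j.1) j.2 z| * t j.1 ^ n ≤
        3 ^ β * unitVol n * θ ^ (Nat.dist i.1 j.1) *
        ((6 * max (t i.1) (t j.1)) ^ n)⁻¹ *
        if dist (i.2 : Rn n) j.2 ≤ 2 * (6 * max (t i.1) (t j.1)) then t j.1 ^ n else 0 := by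
      intro j
      have h1 := abs_integral_dilate_mul_le_ite hβ (hφ i) (hφ j)
        (by linarith [htpos i.1] : 0 < 6 * t i.1) (by linarith [htpos j.1] : 0 < 6 * t j.1)
        i.2 j.2
      have h2 : (min (6 * t i.1) (6 * t j.1) / max (6 * t i.1) (6 * t j.1)) ^ β =
          θ ^ (Nat.dist i.1 j.1) := by
        rw [hθ, ← Real.rpow_natCast, ← Real.rpow_mul (by norm_num), mul_comm β,
          Real.rpow_mul (by norm_num), Real.rpow_natCast, hratio]
      rw [h2, ← mul_max_of_nonneg _ _ (by norm_num : (0 : ℝ) ≤ 6), Real.rpow_neg (hR _).le,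
        Real.rpow_natCast] at h1
      have h3 := htpos j.1
      refine (mul_le_mul_of_nonneg_right h1 (by positivity)).trans_eq ?_
      split_ifs <;> ring
    rw [← ENNReal.ofReal_le_ofReal_iff hMpos.le]
    calc ENNReal.ofReal (∑ j ∈ S, |∫ z, dilate (φ i) (6 * t i.1) i.2 z *
          dilate (φ j) (6 * t j.1) j.2 z| * t j.1 ^ n)
        = ∑ j ∈ S, ENNReal.ofReal (|∫ z, dilate (φ i) (6 * t i.1) i.2 z *
          dilate (φ j) (6 * t j.1) j.2 z| * t j.1 ^ n) :=
          ENNReal.ofReal_sum_of_nonneg fun j _ => by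
            have := htpos j.1
            positivity
      _ ≤ ∑ j ∈ S, ENNReal.ofReal (3 ^ β * unitVol n * θ ^ (Nat.dist i.1 j.1) *
          ((6 * max (t i.1) (t j.1)) ^ n)⁻¹) *
          (if dist (i.2 : Rn n) j.2 ≤ 2 * (6 * max (t i.1) (t j.1)) then
            ENNReal.ofReal (t j.1 ^ n) else 0) := by
          refine Finset.sum_le_sum fun j _ => ?_
          refine (ENNReal.ofReal_le_ofReal (hterm j)).trans_eq ?_
          have := hR j.1
          rw [ENNReal.ofReal_mul (by positivity)]
          split_ifs <;> simp
      _ ≤ ∑' l, ∑' y : N l, ENNReal.ofReal (3 ^ β * unitVol n * θ ^ (Nat.dist i.1 l) *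
          ((6 * max (t i.1) (t l)) ^ n)⁻¹) *
          (if dist (i.2 : Rn n) y ≤ 2 * (6 * max (t i.1) (t l)) then
            ENNReal.ofReal (t l ^ n) else 0) := by
          refine (ENNReal.sum_le_tsum S).trans_eq ?_
          rw [ENNReal.tsum_sigma']
      _ ≤ ∑' l, ENNReal.ofReal (3 ^ β * unitVol n * 3 ^ n) *
          ENNReal.ofReal θ ^ (Nat.dist i.1 l) := by
          refine ENNReal.tsum_le_tsum fun l => ?_
          rw [ENNReal.tsum_mul_left]
          refine (mul_le_mul_right (tsum_net_le (hN l) (htpos l) (R := 6 * max (t i.1) (t l))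
            (by linarith [le_max_right (t i.1) (t l), htpos l]) _) _).trans_eq ?_
          have := hR l
          rw [← ENNReal.ofReal_mul (by positivity), ← ENNReal.ofReal_pow hθ0.le,
            ← ENNReal.ofReal_mul (by positivity)]
          congr 1
          field_simp
          rw [mul_pow]
      _ ≤ ENNReal.ofReal M := by
          rw [ENNReal.tsum_mul_left, hM, ENNReal.ofReal_mul (p := 3 ^ β * unitVol n * 3 ^ n)
            (by positivity), ENNReal.ofReal_mul zero_le_two, ENNReal.ofReal_ofNat,
            ENNReal.ofReal_inv_of_pos (by linarith), ENNReal.ofReal_sub _ hθ0.le,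
            ENNReal.ofReal_one]
          gcongr
          exact tsum_pow_dist_le (ENNReal.ofReal_le_one.2 hθ1.le) _
  have hmain := sum_inner_sq_div_le S
    (fun i => t i.1 ^ n • (hmem i).toLp (dilate (φ i) (6 * t i.1) i.2))
    (fun i => t i.1 ^ n * M) (fun i _ => mul_pos (pow_pos (htpos _) _) hMpos) ?_ (hf.toLp f)
  · rw [← real_inner_self_eq_norm_sq, hinner hf hf] at hmain
    simp only [inner_smul_right, hinner hf (hmem _)] at hmain
    rw [← div_le_iff₀' hMpos, Finset.sum_div]
    refine le_trans (le_of_eq (Finset.sum_congr rfl fun i _ => ?_))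
      (hmain.trans_eq (by simp only [sq]))
    have := htpos i.1
    change t i.1 ^ n * (∫ x, f x * dilate (φ i) (6 * t i.1) i.2 x) ^ 2 / M = _
    field_simp
  · intro i hi
    simp only [inner_smul_left, inner_smul_right, hinner (hmem _) (hmem _), RCLike.conj_to_real,
      abs_mul, abs_pow, abs_of_pos (htpos _)]
    simp only [mul_left_comm _ (t i.1 ^ n)]
    rw [← Finset.mul_sum]
    refine mul_le_mul_of_nonneg_left ?_ (pow_pos (htpos _) _).le
    simpa only [mul_comm (t _ ^ n)] using key i hi

end AlmostOrthogonality

section SquareFunctionBound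

open scoped ENNReal

variable {β : ℝ}

lemma exists_Abeta_le_two_mul {f : Rn n → ℝ} {t : ℝ} {x : Rn n} :
    ∃ φ : Rn n → ℝ, MemCbeta β φ ∧ Abeta β f x t ≤ 2 * |convPhi f φ t x| := by
  rcases (Abeta_nonneg (β := β) f x t).eq_or_lt with h | h
  · exact ⟨0, memCbeta_zero, by rw [← h]; positivity⟩
  · have : Nonempty {φ : Rn n → ℝ // MemCbeta β φ} := ⟨⟨0, memCbeta_zero⟩⟩
    obtain ⟨φ, hφ⟩ := exists_lt_of_lt_ciSup (half_lt_self h)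
    have hφ' : Abeta β f x t / 2 < |convPhi f φ.1 t x| := hφ
    exact ⟨φ.1, φ.2, by linarith⟩

/-- The `L²` bound for the discrete intrinsic square function. -/
lemma lintegral_tsum_Abeta_sq_lt_top (hβ : 0 < β) {f : Rn n → ℝ} (hf : MemLp f 2 volume)
    {r₀ : ℝ} (hr₀ : 0 < r₀) :
    ∫⁻ x, ∑' k : ℕ, ENNReal.ofReal (Abeta β f x (r₀ / 2 ^ k) ^ 2) < ∞ := by
  have hloc : LocallyIntegrable f := hf.locallyIntegrable one_le_two
  obtain ⟨M, -, hM⟩ := exists_bessel_dilate n hβ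
  have htpos : ∀ k : ℕ, 0 < r₀ / 2 ^ k := fun k => by positivity
  choose N hNd hNc using fun k => exists_disjoint_net (Rn n) (htpos k)
  choose φ hφ hφA using fun i : Σ k, N k =>
    exists_Abeta_le_two_mul (β := β) (f := f) (t := 6 * (r₀ / 2 ^ i.1)) (x := i.2)
  have hv := unitVol_pos (n := n)
  set c : ℝ := 5 ^ n * unitVol n * (6 ^ ((n : ℝ) + β) * 2) ^ 2 with hc
  have hlevel : ∀ k, ∫⁻ x, ENNReal.ofReal (Abeta β f x (r₀ / 2 ^ k) ^ 2) ≤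
      ∑' y : N k, ENNReal.ofReal c * ENNReal.ofReal ((r₀ / 2 ^ k) ^ n *
        convPhi f (φ ⟨k, y⟩) (6 * (r₀ / 2 ^ k)) y ^ 2) := by
    intro k
    set t := r₀ / 2 ^ k with ht
    have htk : 0 < t := htpos k
    have : Countable (N k) := ((hNd k).countable_of_isOpen (fun _ _ => isOpen_ball)
      fun y _ => ⟨y, mem_ball_self htk⟩).to_subtype
    have hcov : (⋃ y : N k, closedBall (y : Rn n) (5 * t)) = univ := by
      refine eq_univ_of_forall fun x => ?_
      obtain ⟨y, hy, hxy⟩ := hNc k x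
      exact mem_iUnion.2 ⟨⟨y, hy⟩, hxy⟩
    rw [← setLIntegral_univ, ← hcov]
    refine (lintegral_iUnion_le _ _).trans (ENNReal.tsum_le_tsum fun y => ?_)
    set a := convPhi f (φ ⟨k, y⟩) (6 * t) y with ha
    have hbound : ∀ x ∈ closedBall (y : Rn n) (5 * t), ENNReal.ofReal (Abeta β f x t ^ 2) ≤
        ENNReal.ofReal ((6 ^ ((n : ℝ) + β) * 2) ^ 2 * a ^ 2) := fun x hx => by
      refine ENNReal.ofReal_le_ofReal ?_
      rw [← sq_abs a, ← mul_pow]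
      refine pow_le_pow_left₀ (Abeta_nonneg _ _ _) ?_ 2
      have h1 := Abeta_le_mul_Abeta hβ hloc htk (s := 6 * t) (y := x) (y' := y)
        (by linarith [mem_closedBall.1 hx])
      rw [mul_div_cancel_right₀ _ htk.ne'] at h1
      refine h1.trans ?_
      rw [mul_assoc]
      gcongr
      exact hφA ⟨k, y⟩
    refine (setLIntegral_mono measurable_const hbound).trans_eq ?_
    rw [setLIntegral_const, volume_closedBall_Rn _ (by positivity),
      ← ENNReal.ofReal_mul (by positivity), ← ENNReal.ofReal_mul (by positivity), hc]
    congr 1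
    rw [mul_pow 5 t]
    ring
  rw [lintegral_tsum fun k =>
    ((measurable_Abeta_left hβ hloc (htpos k)).pow_const 2).ennreal_ofReal.aemeasurable]
  refine (ENNReal.tsum_le_tsum hlevel).trans_lt ?_
  simp only [ENNReal.tsum_mul_left]
  refine ENNReal.mul_lt_top ENNReal.ofReal_lt_top ?_
  rw [← ENNReal.tsum_sigma' (fun i : Σ k, N k => ENNReal.ofReal ((r₀ / 2 ^ i.1) ^ n *
    convPhi f (φ i) (6 * (r₀ / 2 ^ i.1)) i.2 ^ 2)), ENNReal.tsum_eq_iSup_sum]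
  refine (iSup_le fun S => ?_).trans_lt (ENNReal.ofReal_lt_top (r := M * ∫ x, f x ^ 2))
  rw [← ENNReal.ofReal_sum_of_nonneg fun i _ => by have := htpos i.1; positivity]
  exact ENNReal.ofReal_le_ofReal (hM r₀ hr₀ N hNd φ hφ S f hf)

end SquareFunctionBound

section WhitneyAverage

open scoped ENNReal

variable {β : ℝ}

/-- The kernel averaging a function over the balls `B(z, d(z) / 2)`, where `d` is the distance
to the set `K`. -/
def whitneyKernel (K : Set (Rn n)) (z y : Rn n) : ℝ :=
  if dist y z < infDist z K / 2 then ((infDist z K / 2) ^ n * unitVol n)⁻¹ else 0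

lemma whitneyKernel_nonneg (K : Set (Rn n)) (z y : Rn n) : 0 ≤ whitneyKernel K z y := by
  have h1 := unitVol_pos (n := n)
  have h2 := infDist_nonneg (x := z) (s := K)
  rw [whitneyKernel]
  split_ifs <;> positivity

lemma measurable_whitneyKernel (K : Set (Rn n)) :
    Measurable fun p : Rn n × Rn n => whitneyKernel K p.1 p.2 := by
  have hd : Measurable fun p : Rn n × Rn n => infDist p.1 K / 2 :=
    ((continuous_infDist_pt K).measurable.comp measurable_fst).div_const 2
  refine Measurable.ite (measurableSet_lt (measurable_snd.dist measurable_fst) hd) ?_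
    measurable_const
  exact ((hd.pow_const n).mul_const _).inv

lemma whitneyKernel_eq_indicator (K : Set (Rn n)) (z : Rn n) :
    whitneyKernel K z = (ball z (infDist z K / 2)).indicator
      fun _ => ((infDist z K / 2) ^ n * unitVol n)⁻¹ := by
  ext y
  by_cases h : dist y z < infDist z K / 2
  · rw [whitneyKernel, if_pos h, indicator_of_mem (mem_ball.2 h)]
  · rw [whitneyKernel, if_neg h, indicator_of_notMem (mt mem_ball.1 h)]

lemma whitneyKernel_of_mem {K : Set (Rn n)} {z : Rn n} (hz : z ∈ K) (y : Rn n) :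
    whitneyKernel K z y = 0 := by
  rw [whitneyKernel, infDist_zero_of_mem hz, if_neg]
  simp

lemma whitneyKernel_of_mem_right {K : Set (Rn n)} (z : Rn n) {y : Rn n} (hy : y ∈ K) :
    whitneyKernel K z y = 0 := by
  rw [whitneyKernel, if_neg]
  have := infDist_le_dist_of_mem (x := z) hy
  rw [dist_comm] at this
  linarith [dist_nonneg (x := y) (y := z)]

lemma integrable_whitneyKernel (K : Set (Rn n)) (z : Rn n) : Integrable (whitneyKernel K z) := by
  rw [whitneyKernel_eq_indicator, integrable_indicator_iff measurableSet_ball]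
  exact integrableOn_const measure_ball_lt_top.ne

lemma integral_whitneyKernel {K : Set (Rn n)} {z : Rn n} (hz : 0 < infDist z K) :
    ∫ y, whitneyKernel K z y = 1 := by
  rw [whitneyKernel_eq_indicator, integral_indicator measurableSet_ball, setIntegral_const,
    Measure.real, volume_ball_Rn _ (by positivity), smul_eq_mul, ENNReal.toReal_ofReal]
  · have := unitVol_pos (n := n)
    field_simp
  · have := unitVol_pos (n := n)
    positivity

lemma integral_whitneyKernel_le_one (K : Set (Rn n)) (z : Rn n) :
    ∫ y, whitneyKernel K z y ≤ 1 := by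
  rcases (infDist_nonneg (x := z) (s := K)).eq_or_lt with h | h
  · have : whitneyKernel K z = 0 := by
      ext y
      rw [whitneyKernel, ← h, if_neg (by simp), Pi.zero_apply]
    simp [this]
  · exact (integral_whitneyKernel h).le

lemma integrable_mul_whitneyKernel {f : Rn n → ℝ} (hf : Integrable f) (K : Set (Rn n)) :
    Integrable (fun p : Rn n × Rn n => f p.1 * whitneyKernel K p.1 p.2) (volume.prod volume) := by
  have hm : AEStronglyMeasurable (fun p : Rn n × Rn n => f p.1 * whitneyKernel K p.1 p.2)
      (volume.prod volume) :=
    hf.1.comp_fst.mul (measurable_whitneyKernel K).aestronglyMeasurable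
  rw [integrable_prod_iff hm]
  refine ⟨ae_of_all _ fun z => (integrable_whitneyKernel K z).const_mul (f z), ?_⟩
  refine hf.mono hm.norm.integral_prod_right' (ae_of_all _ fun z => ?_)
  simp only [norm_mul, Real.norm_of_nonneg (whitneyKernel_nonneg K z _)]
  rw [integral_const_mul, norm_mul, norm_norm, Real.norm_of_nonneg
    (integral_nonneg fun y => whitneyKernel_nonneg K z y)]
  exact mul_le_of_le_one_right (norm_nonneg _) (integral_whitneyKernel_le_one K z)

/-- The good part of a Calderón–Zygmund decomposition of `f` relative to the set `K`. -/
def goodPart (K : Set (Rn n)) (f : Rn n → ℝ) (y : Rn n) : ℝ :=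
  K.indicator f y + ∫ z, f z * whitneyKernel K z y

lemma integrable_goodPart {f : Rn n → ℝ} (hf : Integrable f) {K : Set (Rn n)} (hK : IsClosed K) :
    Integrable (goodPart K f) :=
  (hf.indicator hK.measurableSet).add (integrable_mul_whitneyKernel hf K).integral_prod_right

lemma abs_le_of_setIntegral_ball_le {f : Rn n → ℝ} (hf : LocallyIntegrable f) {lam : ℝ} :
    ∀ᵐ x : Rn n, (∀ r > 0, ∫ y in ball x r, |f y| ≤ lam * r ^ n) →
      |f x| ≤ 2 ^ n * lam / unitVol n := by
  have hv := unitVol_pos (n := n)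
  have habs : LocallyIntegrable (fun x => |f x|) :=
    hf.mono hf.aestronglyMeasurable.norm (ae_of_all _ fun x => by simp)
  filter_upwards [(Besicovitch.vitaliFamily (volume : Measure (Rn n))).ae_tendsto_average habs]
    with x hx hb
  have hx' := hx.comp (Besicovitch.tendsto_filterAt volume x)
  refine le_of_tendsto hx' ?_
  filter_upwards [self_mem_nhdsWithin] with r hr
  have hr : 0 < r := hr
  simp only [Function.comp]
  rw [setAverage_eq, volume_real_closedBall_Rn x hr, smul_eq_mul, inv_mul_le_iff₀ (by positivity)]
  have h1 : ∫ y in closedBall x r, |f y| ≤ ∫ y in ball x (2 * r), |f y| :=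
    setIntegral_mono_set ((habs.integrableOn_isCompact (isCompact_closedBall x (2 * r))).mono_set
      ball_subset_closedBall) (ae_of_all _ fun _ => abs_nonneg _)
      (closedBall_subset_ball (by linarith)).eventuallyLE
  refine (h1.trans (hb (2 * r) (by positivity))).trans_eq ?_
  field_simp
  ring

lemma abs_goodPart_le {f : Rn n → ℝ} (hf : Integrable f) {K : Set (Rn n)} (hK : IsClosed K)
    (hKn : K.Nonempty) {lam : ℝ}
    (hlam : ∀ x ∈ K, ∀ r > 0, ∫ y in ball x r, |f y| ≤ lam * r ^ n) :
    ∀ᵐ y : Rn n, |goodPart K f y| ≤ 6 ^ n * lam / unitVol n := by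
  have hv := unitVol_pos (n := n)
  have hlam0 : 0 ≤ lam := by
    obtain ⟨x, hx⟩ := hKn
    have := (integral_nonneg fun y => abs_nonneg (f y)).trans (hlam x hx 1 one_pos)
    simpa using this
  filter_upwards [abs_le_of_setIntegral_ball_le (lam := lam) hf.locallyIntegrable] with y hy
  by_cases hyK : y ∈ K
  · simp only [goodPart, whitneyKernel_of_mem_right _ hyK, mul_zero, integral_zero, add_zero,
      indicator_of_mem hyK]
    refine (hy (hlam y hyK)).trans ?_
    gcongr
    norm_num
  · have hd : 0 < infDist y K := (hK.notMem_iff_infDist_pos hKn).1 hyK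
    obtain ⟨p, hp, hpd⟩ := hK.exists_infDist_eq_dist hKn y
    rw [goodPart, indicator_of_notMem hyK, zero_add]
    set d := infDist y K with hd_def
    have hle : ∀ z, ‖f z * whitneyKernel K z y‖ ≤
        (ball p (2 * d)).indicator (fun z => ((d / 3) ^ n * unitVol n)⁻¹ * |f z|) z := by
      intro z
      rw [norm_mul, Real.norm_of_nonneg (whitneyKernel_nonneg K z y), whitneyKernel]
      split_ifs with hyz
      · have h1 : d ≤ infDist z K + dist y z := infDist_le_infDist_add_dist
        have h2 : infDist z K ≤ d + dist z y := infDist_le_infDist_add_dist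
        rw [dist_comm z y] at h2
        have hz : z ∈ ball p (2 * d) := by
          rw [mem_ball]
          have := dist_triangle z y p
          rw [dist_comm z y] at this
          linarith
        have h3 : d / 3 ≤ infDist z K / 2 := by linarith
        rw [indicator_of_mem hz, mul_comm, Real.norm_eq_abs]
        gcongr
      · rw [mul_zero]
        exact indicator_nonneg (fun z _ => by positivity) z
    refine (norm_integral_le_of_norm_le ?_ (ae_of_all _ hle)).trans ?_
    · exact ((hf.abs).const_mul _).indicator measurableSet_ball
    · rw [integral_indicator measurableSet_ball, integral_const_mul]
      refine (mul_le_mul_of_nonneg_left (hlam p hp (2 * d) (by positivity))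
        (by positivity)).trans_eq ?_
      rw [div_pow, mul_pow]
      have : (6 : ℝ) ^ n = 2 ^ n * 3 ^ n := by rw [← mul_pow]; norm_num
      rw [this]
      field_simp

lemma memLp_two_of_ae_abs_le {f : Rn n → ℝ} (hf : Integrable f) {c : ℝ} (h : ∀ᵐ x, |f x| ≤ c) :
    MemLp f 2 volume := by
  rw [memLp_two_iff_integrable_sq hf.1]
  simp only [sq]
  exact hf.bdd_mul hf.1 h

end WhitneyAverage

section BadPart

open scoped ENNReal

variable {β : ℝ}

lemma MemCbeta.abs_dilate_le (hβ : 0 < β) {φ : Rn n → ℝ} (hφ : MemCbeta β φ) {t : ℝ}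
    (ht : 0 < t) (x y : Rn n) : |dilate φ t x y| ≤ t ^ (-(n : ℝ)) * 3 ^ β := by
  rw [dilate, abs_mul, abs_of_nonneg (by positivity)]
  gcongr
  exact hφ.abs_le hβ _

lemma convPhi_sub_goodPart (hβ : 0 < β) {φ : Rn n → ℝ} (hφ : MemCbeta β φ) {f : Rn n → ℝ}
    (hf : Integrable f) {K : Set (Rn n)} (hK : IsClosed K) (hKn : K.Nonempty) {t : ℝ}
    (ht : 0 < t) (x : Rn n) :
    convPhi (fun y => f y - goodPart K f y) φ t x =
      ∫ z, f z * ∫ y, whitneyKernel K z y * (dilate φ t x z - dilate φ t x y) := by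
  set D := dilate φ t x
  have hDc : Continuous D := hφ.continuous_dilate hβ t x
  have hDb : ∀ y, ‖D y‖ ≤ t ^ (-(n : ℝ)) * 3 ^ β := hφ.abs_dilate_le hβ ht x
  have hmulD : ∀ {g : Rn n → ℝ}, Integrable g → Integrable fun y => g y * D y := fun hg =>
    hg.mul_bdd hDc.aestronglyMeasurable (ae_of_all _ hDb)
  have hprod := integrable_mul_whitneyKernel hf K
  have hprodD : Integrable (fun p : Rn n × Rn n => f p.1 * whitneyKernel K p.1 p.2 * D p.2)
      (volume.prod volume) :=
    hprod.mul_bdd (hDc.comp continuous_snd).aestronglyMeasurable (ae_of_all _ fun p => hDb p.2)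
  have hind : Integrable (K.indicator f) := hf.indicator hK.measurableSet
  have hκ : ∀ z, f z * ∫ y, whitneyKernel K z y * (D z - D y) =
      (f z * D z - K.indicator f z * D z) - ∫ y, f z * whitneyKernel K z y * D y := by
    intro z
    have h1 : ∫ y, f z * whitneyKernel K z y * D y = f z * ∫ y, whitneyKernel K z y * D y := by
      rw [← integral_const_mul]
      simp only [mul_assoc]
    have h2 : ∫ y, whitneyKernel K z y * (D z - D y) =
        (∫ y, whitneyKernel K z y) * D z - ∫ y, whitneyKernel K z y * D y := by
      simp only [mul_sub]
      rw [integral_sub ((integrable_whitneyKernel K z).mul_const _)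
        (hmulD (integrable_whitneyKernel K z)), integral_mul_const]
    rw [h1, h2]
    by_cases hz : z ∈ K
    · simp [whitneyKernel_of_mem hz, hz]
    · rw [integral_whitneyKernel ((hK.notMem_iff_infDist_pos hKn).1 hz),
        indicator_of_notMem hz]
      ring
  simp only [hκ]
  have hdiff : Integrable fun y => f y * D y - K.indicator f y * D y :=
    (hmulD hf).sub (hmulD hind)
  have hleft : Integrable fun z => ∫ y, f z * whitneyKernel K z y * D y :=
    hprodD.integral_prod_left
  have hright : Integrable fun y => (∫ z, f z * whitneyKernel K z y) * D y :=
    hmulD hprod.integral_prod_right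
  rw [integral_sub hdiff hleft, integral_integral_swap hprodD]
  change ∫ y, (f y - goodPart K f y) * D y = _
  have h3 : ∀ y, (f y - goodPart K f y) * D y =
      f y * D y - K.indicator f y * D y - (∫ z, f z * whitneyKernel K z y) * D y := fun y => by
    rw [goodPart]; ring
  simp only [h3]
  rw [integral_sub hdiff hright]
  simp only [integral_mul_const]

lemma abs_integral_whitneyKernel_mul_le {φ : Rn n → ℝ} (hφ : MemCbeta β φ) (hβ : 0 < β)
    {K : Set (Rn n)} {t : ℝ} (ht : 0 < t) {x : Rn n} (hx : x ∈ K) (z : Rn n) :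
    |∫ y, whitneyKernel K z y * (dilate φ t x z - dilate φ t x y)| ≤
      (closedBall x (2 * t)).indicator
        (fun z => t ^ (-(n : ℝ)) * (infDist z K / t) ^ β) z := by
  have hd := infDist_nonneg (x := z) (s := K)
  by_cases hz : z ∈ closedBall x (2 * t)
  · rw [indicator_of_mem hz]
    have hle : ∀ y, ‖whitneyKernel K z y * (dilate φ t x z - dilate φ t x y)‖ ≤
        whitneyKernel K z y * (t ^ (-(n : ℝ)) * (infDist z K / t) ^ β) := fun y => by
      rw [norm_mul, Real.norm_of_nonneg (whitneyKernel_nonneg K z y)]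
      by_cases hy : dist y z < infDist z K / 2
      · refine mul_le_mul_of_nonneg_left ((hφ.abs_dilate_sub_le ht x z y).trans ?_)
          (whitneyKernel_nonneg K z y)
        gcongr
        rw [dist_comm]; linarith
      · simp [whitneyKernel, hy]
    have h1 := norm_integral_le_of_norm_le ((integrable_whitneyKernel K z).mul_const _)
      (ae_of_all _ hle)
    rw [integral_mul_const] at h1
    exact h1.trans (mul_le_of_le_one_left (by positivity) (integral_whitneyKernel_le_one K z))
  · rw [indicator_of_notMem hz]
    rw [mem_closedBall, not_le] at hz
    have hzero : ∀ y, whitneyKernel K z y * (dilate φ t x z - dilate φ t x y) = 0 := fun y => by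
      by_cases hy : dist y z < infDist z K / 2
      · have h1 := infDist_le_dist_of_mem (x := z) hx
        have h2 := dist_triangle z y x
        rw [dist_comm z y] at h2
        rw [dilate, dilate, hφ.eq_zero_of_lt_dist ht (by rw [dist_comm]; linarith),
          hφ.eq_zero_of_lt_dist ht (by rw [dist_comm]; linarith)]
        simp
      · simp [whitneyKernel, hy]
    simp [hzero]

/-- A Marcinkiewicz type function controlling the bad part of the Calderón–Zygmund
decomposition. -/
def marcinkiewicz (β : ℝ) (K : Set (Rn n)) (f : Rn n → ℝ) (t : ℝ) (x : Rn n) : ℝ≥0∞ :=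
  ∫⁻ z, (closedBall x (2 * t)).indicator
    (fun z => ENNReal.ofReal (|f z| * (t ^ (-(n : ℝ)) * (infDist z K / t) ^ β))) z

lemma marcinkiewicz_le (hβ : 0 < β) {K : Set (Rn n)} {f : Rn n → ℝ} (hf : Integrable f) {lam : ℝ}
    (hlam : ∀ x ∈ K, ∀ r > 0, ∫ y in ball x r, |f y| ≤ lam * r ^ n) {t : ℝ} (ht : 0 < t)
    {x : Rn n} (hx : x ∈ K) :
    marcinkiewicz β K f t x ≤ ENNReal.ofReal (2 ^ β * 3 ^ n * lam) := by
  rw [marcinkiewicz, lintegral_indicator measurableSet_closedBall]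
  calc ∫⁻ z in closedBall x (2 * t),
        ENNReal.ofReal (|f z| * (t ^ (-(n : ℝ)) * (infDist z K / t) ^ β))
      ≤ ∫⁻ z in closedBall x (2 * t), ENNReal.ofReal (t ^ (-(n : ℝ)) * 2 ^ β * |f z|) := by
        refine setLIntegral_mono' measurableSet_closedBall fun z hz => ?_
        refine ENNReal.ofReal_le_ofReal ?_
        rw [mul_comm]
        have h1 : infDist z K / t ≤ 2 := by
          rw [div_le_iff₀ ht]
          exact (infDist_le_dist_of_mem hx).trans hz
        have h2 := infDist_nonneg (x := z) (s := K)
        gcongr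
    _ ≤ ∫⁻ z in ball x (3 * t), ENNReal.ofReal (t ^ (-(n : ℝ)) * 2 ^ β * |f z|) :=
        lintegral_mono_set (closedBall_subset_ball (by linarith))
    _ = ENNReal.ofReal (∫ z in ball x (3 * t), t ^ (-(n : ℝ)) * 2 ^ β * |f z|) :=
        (ofReal_integral_eq_lintegral_ofReal (hf.abs.const_mul _).integrableOn
          (ae_of_all _ fun z => by positivity)).symm
    _ ≤ _ := by
        refine ENNReal.ofReal_le_ofReal ?_
        rw [integral_const_mul]
        refine (mul_le_mul_of_nonneg_left (hlam x hx (3 * t) (by positivity))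
          (by positivity)).trans_eq ?_
        rw [Real.rpow_neg ht.le, Real.rpow_natCast, mul_pow]
        field_simp

lemma Abeta_bad_le (hβ : 0 < β) {f : Rn n → ℝ} (hf : Integrable f) {K : Set (Rn n)}
    (hK : IsClosed K) {lam : ℝ}
    (hlam : ∀ x ∈ K, ∀ r > 0, ∫ y in ball x r, |f y| ≤ lam * r ^ n) {t : ℝ} (ht : 0 < t)
    {x : Rn n} (hx : x ∈ K) :
    ENNReal.ofReal (Abeta β (fun y => f y - goodPart K f y) x t) ≤ marcinkiewicz β K f t x := by
  have hfin : marcinkiewicz β K f t x ≠ ∞ :=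
    ((marcinkiewicz_le hβ hf hlam ht hx).trans_lt ENNReal.ofReal_lt_top).ne
  rw [ENNReal.ofReal_le_iff_le_toReal hfin]
  refine Abeta_le fun φ hφ => ?_
  rw [convPhi_sub_goodPart hβ hφ hf hK ⟨x, hx⟩ ht, ← ENNReal.ofReal_le_iff_le_toReal hfin,
    ← Real.enorm_eq_ofReal_abs]
  refine (enorm_integral_le_lintegral_enorm _).trans (lintegral_mono fun z => ?_)
  have h := abs_integral_whitneyKernel_mul_le hφ hβ ht hx z
  by_cases hz : z ∈ closedBall x (2 * t)
  · rw [indicator_of_mem hz] at h ⊢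
    rw [Real.enorm_eq_ofReal_abs, abs_mul]
    gcongr
  · rw [indicator_of_notMem hz] at h ⊢
    rw [abs_nonpos_iff.1 h]
    simp

end BadPart

section CalderonZygmund

open scoped ENNReal

variable {β : ℝ}

lemma sum_ite_rpow_le (hβ : 0 < β) {a : ℝ} (ha : 0 ≤ a) (m : ℕ) :
    ∑ k ∈ Finset.range m, (if a * 2 ^ k ≤ 2 then (a * 2 ^ k) ^ β else 0) ≤
      2 ^ β * (1 - (1 / 2) ^ β)⁻¹ := by
  set θ : ℝ := (1 / 2) ^ β with hθ
  have hθ0 : 0 < θ := by positivity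
  have hθ1 : θ < 1 := Real.rpow_lt_one (by norm_num) (by norm_num) hβ
  have h1θ : 0 < 1 - θ := by linarith
  induction m with
  | zero => simp only [Finset.range_zero, Finset.sum_empty]; positivity
  | succ m ih =>
    by_cases hm : a * 2 ^ m ≤ 2
    · have hterm : ∀ k ∈ Finset.range (m + 1),
          (if a * 2 ^ k ≤ 2 then (a * 2 ^ k) ^ β else 0) ≤ 2 ^ β * θ ^ (m - k) := fun k hk => by
        have hk : k ≤ m := Nat.lt_succ_iff.1 (Finset.mem_range.1 hk)
        have h2 : (a * 2 ^ k) ^ β ≤ 2 ^ β * θ ^ (m - k) := by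
          have hpow : θ ^ (m - k) = ((1 / 2 : ℝ) ^ (m - k)) ^ β := by
            rw [hθ, ← Real.rpow_natCast, ← Real.rpow_mul (by norm_num), mul_comm β,
              Real.rpow_mul (by norm_num), Real.rpow_natCast]
          rw [hpow, ← Real.mul_rpow (by norm_num) (by positivity)]
          refine Real.rpow_le_rpow (by positivity) ?_ hβ.le
          obtain ⟨l, rfl⟩ := Nat.exists_eq_add_of_le hk
          rw [Nat.add_sub_cancel_left, one_div, inv_pow, ← div_eq_mul_inv,
            le_div_iff₀ (by positivity)]
          rw [pow_add] at hm
          linarith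
        split_ifs
        · exact h2
        · positivity
      refine (Finset.sum_le_sum hterm).trans ?_
      rw [← Finset.mul_sum, Finset.sum_flip (fun j => θ ^ j),
        ← tsum_geometric_of_lt_one hθ0.le hθ1]
      gcongr
      exact (summable_geometric_of_lt_one hθ0.le hθ1).sum_le_tsum _ fun _ _ => by positivity
    · rw [Finset.sum_range_succ, if_neg hm, add_zero]
      exact ih

lemma measurable_marcinkiewicz_integrand {f : Rn n → ℝ} (hf : Measurable f) (K : Set (Rn n))
    (t : ℝ) : Measurable fun p : Rn n × Rn n => (closedBall p.1 (2 * t)).indicator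
      (fun z => ENNReal.ofReal (|f z| * (t ^ (-(n : ℝ)) * (infDist z K / t) ^ β))) p.2 := by
  have hF : Measurable fun z =>
      ENNReal.ofReal (|f z| * (t ^ (-(n : ℝ)) * (infDist z K / t) ^ β)) :=
    ((measurable_norm.comp hf).mul ((((continuous_infDist_pt K).measurable.div_const t).pow_const
      β).const_mul _)).ennreal_ofReal
  have hS : MeasurableSet {p : Rn n × Rn n | dist p.2 p.1 ≤ 2 * t} :=
    measurableSet_le (measurable_snd.dist measurable_fst) measurable_const
  exact (hF.comp measurable_snd).indicator hS

lemma measurable_marcinkiewicz {f : Rn n → ℝ} (hf : Measurable f) (K : Set (Rn n)) (t : ℝ) :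
    Measurable (marcinkiewicz β K f t) :=
  (measurable_marcinkiewicz_integrand hf K t).lintegral_prod_right'

lemma setLIntegral_marcinkiewicz_le {f : Rn n → ℝ} (hf : Measurable f) {K : Set (Rn n)}
    (hK : IsClosed K) {t : ℝ} (ht : 0 < t) :
    ∫⁻ x in K, marcinkiewicz β K f t x ≤ ∫⁻ z, ENNReal.ofReal (2 ^ n * unitVol n * |f z|) *
      ENNReal.ofReal (if infDist z K / t ≤ 2 then (infDist z K / t) ^ β else 0) := by
  have hv := unitVol_pos (n := n)
  simp only [marcinkiewicz]
  rw [lintegral_lintegral_swap (measurable_marcinkiewicz_integrand hf K t).aemeasurable]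
  refine lintegral_mono fun z => ?_
  have hd := infDist_nonneg (x := z) (s := K)
  split_ifs with h
  · calc _ ≤ ∫⁻ x in K, (closedBall z (2 * t)).indicator (fun _ =>
          ENNReal.ofReal (|f z| * (t ^ (-(n : ℝ)) * (infDist z K / t) ^ β))) x := by
          refine lintegral_mono fun x => ?_
          by_cases hx : z ∈ closedBall x (2 * t)
          · rw [indicator_of_mem hx, indicator_of_mem (by rwa [mem_closedBall, dist_comm])]
          · rw [indicator_of_notMem hx]; exact zero_le
      _ ≤ ∫⁻ x, (closedBall z (2 * t)).indicator (fun _ =>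
          ENNReal.ofReal (|f z| * (t ^ (-(n : ℝ)) * (infDist z K / t) ^ β))) x :=
          setLIntegral_le_lintegral _ _
      _ = _ := by
          rw [lintegral_indicator measurableSet_closedBall, setLIntegral_const,
            volume_closedBall_Rn _ (by positivity), ← ENNReal.ofReal_mul (by positivity),
            ← ENNReal.ofReal_mul (by positivity), Real.rpow_neg ht.le, Real.rpow_natCast, mul_pow]
          congr 1
          field_simp
  · rw [ENNReal.ofReal_zero, mul_zero, nonpos_iff_eq_zero, ← lintegral_zero]
    refine setLIntegral_congr_fun hK.measurableSet fun x hx => ?_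
    refine indicator_of_notMem (fun hz => h ?_) _
    rw [div_le_iff₀ ht]
    exact (infDist_le_dist_of_mem hx).trans hz

lemma setLIntegral_tsum_marcinkiewicz_lt_top (hβ : 0 < β) {f : Rn n → ℝ} (hfm : Measurable f)
    (hf : Integrable f) {K : Set (Rn n)} (hK : IsClosed K) {r₀ : ℝ} (hr₀ : 0 < r₀) :
    ∫⁻ x in K, ∑' k : ℕ, marcinkiewicz β K f (r₀ / 2 ^ k) x < ∞ := by
  rw [lintegral_tsum fun k => (measurable_marcinkiewicz hfm K _).aemeasurable]
  refine (ENNReal.tsum_le_tsum fun k => setLIntegral_marcinkiewicz_le hfm hK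
    (by positivity : 0 < r₀ / 2 ^ k)).trans_lt ?_
  have hm : ∀ t : ℝ, Measurable fun z =>
      ENNReal.ofReal (if infDist z K / t ≤ 2 then (infDist z K / t) ^ β else 0) := fun t => by
    have hd : Measurable fun z => infDist z K / t :=
      (continuous_infDist_pt K).measurable.div_const t
    exact (Measurable.ite (measurableSet_le hd measurable_const) (hd.pow_const β)
      measurable_const).ennreal_ofReal
  have hfm' : Measurable fun z => ENNReal.ofReal (2 ^ n * unitVol n * |f z|) :=
    ((measurable_norm.comp hfm).const_mul _).ennreal_ofReal
  have hmk : ∀ k : ℕ, AEMeasurable (fun z => ENNReal.ofReal (2 ^ n * unitVol n * |f z|) *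
      ENNReal.ofReal (if infDist z K / (r₀ / 2 ^ k) ≤ 2 then
        (infDist z K / (r₀ / 2 ^ k)) ^ β else 0)) volume :=
    fun k => (hfm'.mul (hm _)).aemeasurable
  rw [← lintegral_tsum hmk]
  calc ∫⁻ z, ∑' k : ℕ, ENNReal.ofReal (2 ^ n * unitVol n * |f z|) *
        ENNReal.ofReal (if infDist z K / (r₀ / 2 ^ k) ≤ 2 then
          (infDist z K / (r₀ / 2 ^ k)) ^ β else 0)
      ≤ ∫⁻ z, ENNReal.ofReal (2 ^ n * unitVol n * |f z|) *
        ENNReal.ofReal (2 ^ β * (1 - (1 / 2) ^ β)⁻¹) := by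
        refine lintegral_mono fun z => ?_
        simp only
        rw [ENNReal.tsum_mul_left]
        gcongr
        have hd := infDist_nonneg (x := z) (s := K)
        refine ENNReal.tsum_le_of_sum_range_le fun m => ?_
        rw [← ENNReal.ofReal_sum_of_nonneg fun k _ => by split_ifs <;> positivity]
        refine ENNReal.ofReal_le_ofReal ?_
        have h := sum_ite_rpow_le hβ (div_nonneg hd hr₀.le) m
        have heq : ∀ k : ℕ, infDist z K / (r₀ / 2 ^ k) = infDist z K / r₀ * 2 ^ k := fun k => by
          field_simp
        simpa only [heq] using h
    _ < ∞ := by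
        rw [lintegral_mul_const _ hfm']
        refine ENNReal.mul_lt_top ?_ ENNReal.ofReal_lt_top
        exact (hf.abs.const_mul _).lintegral_lt_top

/-- Finiteness of the discrete intrinsic square function on a set where the averages of `f`
are bounded. -/
lemma ae_tsum_Abeta_sq_lt_top_of_mem (hβ : 0 < β) {f : Rn n → ℝ} (hfm : Measurable f)
    (hf : Integrable f) {K : Set (Rn n)} (hK : IsClosed K) {lam : ℝ}
    (hlam : ∀ x ∈ K, ∀ r > 0, ∫ y in ball x r, |f y| ≤ lam * r ^ n) {r₀ : ℝ} (hr₀ : 0 < r₀) :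
    ∀ᵐ x, x ∈ K → ∑' k : ℕ, ENNReal.ofReal (Abeta β f x (r₀ / 2 ^ k) ^ 2) < ∞ := by
  rcases K.eq_empty_or_nonempty with rfl | hKn
  · simp
  have hg := integrable_goodPart hf hK
  have hg2 := memLp_two_of_ae_abs_le hg (abs_goodPart_le hf hK hKn hlam)
  have hgfin := lintegral_tsum_Abeta_sq_lt_top hβ hg2 hr₀
  have hbfin := setLIntegral_tsum_marcinkiewicz_lt_top hβ hfm hf hK hr₀
  have htpos : ∀ k : ℕ, 0 < r₀ / 2 ^ k := fun k => by positivity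
  have h1 := ae_lt_top (Measurable.tsum fun k => ((measurable_Abeta_left hβ
    hg.locallyIntegrable (htpos k)).pow_const 2).ennreal_ofReal) hgfin.ne
  have h2 := (ae_restrict_iff' hK.measurableSet).1 (ae_lt_top (Measurable.tsum fun k =>
    measurable_marcinkiewicz hfm K _) hbfin.ne)
  filter_upwards [h1, h2] with x hx1 hx2 hxK
  set c := ENNReal.ofReal (2 ^ β * 3 ^ n * lam) with hc
  have hterm : ∀ k : ℕ, ENNReal.ofReal (Abeta β f x (r₀ / 2 ^ k) ^ 2) ≤
      2 * ENNReal.ofReal (Abeta β (goodPart K f) x (r₀ / 2 ^ k) ^ 2) +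
        2 * (c * marcinkiewicz β K f (r₀ / 2 ^ k) x) := by
    intro k
    set t := r₀ / 2 ^ k
    set b : Rn n → ℝ := fun y => f y - goodPart K f y with hb
    have hbi : Integrable b := hf.sub hg
    have hA : Abeta β f x t ≤ Abeta β (goodPart K f) x t + Abeta β b x t := by
      have := Abeta_add_le hβ hg.locallyIntegrable hbi.locallyIntegrable (htpos k) x
      simpa only [hb, add_sub_cancel] using this
    have hsq : Abeta β f x t ^ 2 ≤ 2 * Abeta β (goodPart K f) x t ^ 2 + 2 * Abeta β b x t ^ 2 := by
      have := pow_le_pow_left₀ (Abeta_nonneg f x t) hA 2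
      nlinarith [sq_nonneg (Abeta β (goodPart K f) x t - Abeta β b x t)]
    refine (ENNReal.ofReal_le_ofReal hsq).trans ?_
    rw [ENNReal.ofReal_add (by positivity) (by positivity), ENNReal.ofReal_mul zero_le_two,
      ENNReal.ofReal_mul zero_le_two, ENNReal.ofReal_ofNat, sq (Abeta β b x t),
      ENNReal.ofReal_mul (Abeta_nonneg _ _ _)]
    have hbad := Abeta_bad_le hβ hf hK hlam (htpos k) hxK
    gcongr
    exact hbad.trans (marcinkiewicz_le hβ hf hlam (htpos k) hxK)
  refine (ENNReal.tsum_le_tsum hterm).trans_lt ?_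
  rw [ENNReal.tsum_add, ENNReal.tsum_mul_left, ENNReal.tsum_mul_left, ENNReal.tsum_mul_left]
  exact ENNReal.add_lt_top.2 ⟨ENNReal.mul_lt_top ENNReal.ofNat_lt_top hx1,
    ENNReal.mul_lt_top ENNReal.ofNat_lt_top (ENNReal.mul_lt_top ENNReal.ofReal_lt_top (hx2 hxK))⟩

end CalderonZygmund

section LocalFiniteness

open scoped ENNReal

variable {β : ℝ}

lemma ae_exists_setIntegral_ball_le {f : Rn n → ℝ} (hf : Integrable f) :
    ∀ᵐ x : Rn n, ∃ N : ℕ, ∀ r > 0, ∫ y in ball x r, |f y| ≤ N * r ^ n := by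
  have hv := unitVol_pos (n := n)
  filter_upwards [(Besicovitch.vitaliFamily (volume : Measure (Rn n))).ae_tendsto_average
    hf.abs.locallyIntegrable] with x hx
  have hx' := hx.comp (Besicovitch.tendsto_filterAt volume x)
  have hev := hx'.eventually (eventually_le_nhds (lt_add_one |f x|))
  obtain ⟨δ, hδ, hδx⟩ := mem_nhdsGT_iff_exists_Ioo_subset.1 hev
  have hδ : 0 < δ := hδ
  set I := ∫ y, |f y|
  have hI : 0 ≤ I := integral_nonneg fun y => abs_nonneg _
  obtain ⟨N, hN⟩ := exists_nat_ge (max (unitVol n * (|f x| + 1)) (I / δ ^ n))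
  refine ⟨N, fun r hr => ?_⟩
  rcases lt_or_ge r δ with hrδ | hrδ
  · have h1 := hδx ⟨hr, hrδ⟩
    simp only [mem_ofPred_eq, Function.comp] at h1
    rw [setAverage_eq, volume_real_closedBall_Rn x hr, smul_eq_mul,
      inv_mul_le_iff₀ (by positivity)] at h1
    have h2 : ∫ y in ball x r, |f y| ≤ ∫ y in closedBall x r, |f y| :=
      setIntegral_mono_set hf.abs.integrableOn (ae_of_all _ fun _ => abs_nonneg _)
        ball_subset_closedBall.eventuallyLE
    have h3 := (le_max_left _ _).trans hN
    calc _ ≤ unitVol n * (|f x| + 1) * r ^ n := by linarith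
      _ ≤ _ := by gcongr
  · have h2 : ∫ y in ball x r, |f y| ≤ I :=
      setIntegral_le_integral hf.abs (ae_of_all _ fun _ => abs_nonneg _)
    have h3 := (le_max_right _ _).trans hN
    rw [div_le_iff₀ (by positivity)] at h3
    calc _ ≤ N * δ ^ n := h2.trans h3
      _ ≤ _ := by gcongr

/-- The discrete intrinsic square function of an integrable function is almost everywhere
finite. -/
lemma ae_tsum_Abeta_sq_lt_top_of_integrable (hβ : 0 < β) {f : Rn n → ℝ} (hfm : Measurable f)
    (hf : Integrable f) {r₀ : ℝ} (hr₀ : 0 < r₀) :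
    ∀ᵐ x, ∑' k : ℕ, ENNReal.ofReal (Abeta β f x (r₀ / 2 ^ k) ^ 2) < ∞ := by
  set S : ℕ → Set (Rn n) := fun N => {x | ∀ r > 0, ∫ y in ball x r, |f y| ≤ N * r ^ n}
  have hS : ∀ N, ∀ x ∈ closure (S N), ∀ r > 0, ∫ y in ball x r, |f y| ≤ 2 ^ n * N * r ^ n := by
    intro N x hx r hr
    obtain ⟨x', hx', hxx'⟩ := Metric.mem_closure_iff.1 hx r hr
    have h1 : ∫ y in ball x r, |f y| ≤ ∫ y in ball x' (2 * r), |f y| :=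
      setIntegral_mono_set hf.abs.integrableOn (ae_of_all _ fun _ => abs_nonneg _)
        (ball_subset_ball' (by linarith)).eventuallyLE
    refine (h1.trans (hx' (2 * r) (by positivity))).trans_eq ?_
    ring
  filter_upwards [ae_exists_setIntegral_ball_le hf, ae_all_iff.2 fun N =>
    ae_tsum_Abeta_sq_lt_top_of_mem hβ hfm hf isClosed_closure (hS N) hr₀] with x ⟨N, hN⟩ hx
  exact hx N (subset_closure hN)

lemma Abeta_congr_ae {f g : Rn n → ℝ} (h : f =ᵐ[volume] g) (x : Rn n) (t : ℝ) :
    Abeta β f x t = Abeta β g x t := by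
  simp only [Abeta, convPhi]
  congr 1
  ext φ
  congr 1
  exact integral_congr_ae (h.mono fun y hy => by simp only [hy])

lemma ae_tsum_Abeta_sq_lt_top (hβ : 0 < β) {f : Rn n → ℝ}
    (hf : LocallyIntegrable f) {r₀ : ℝ} (hr₀ : 0 < r₀) :
    ∀ᵐ x, ∑' k : ℕ, ENNReal.ofReal (Abeta β f x (r₀ / 2 ^ k) ^ 2) < ∞ := by
  have hloc : ∀ N : ℕ, ∀ᵐ x, x ∈ ball (0 : Rn n) N →
      ∑' k : ℕ, ENNReal.ofReal (Abeta β f x (r₀ / 2 ^ k) ^ 2) < ∞ := by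
    intro N
    set g := hf.aestronglyMeasurable.mk f
    have hfg : f =ᵐ[volume] g := hf.aestronglyMeasurable.ae_eq_mk
    have hgm : Measurable g := hf.aestronglyMeasurable.stronglyMeasurable_mk.measurable
    have hB : MeasurableSet (closedBall (0 : Rn n) (N + r₀)) := measurableSet_closedBall
    have hgi : Integrable ((closedBall (0 : Rn n) (N + r₀)).indicator g) := by
      rw [integrable_indicator_iff hB]
      exact (hf.integrableOn_isCompact (isCompact_closedBall _ _)).congr_fun_ae
        (ae_restrict_of_ae hfg)
    filter_upwards [ae_tsum_Abeta_sq_lt_top_of_integrable hβ (hgm.indicator hB) hgi hr₀]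
      with x hx hxN
    have heq : ∀ k : ℕ, Abeta β f x (r₀ / 2 ^ k) =
        Abeta β ((closedBall (0 : Rn n) (N + r₀)).indicator g) x (r₀ / 2 ^ k) := fun k => by
      rw [Abeta_congr_ae hfg]
      refine Abeta_congr (by positivity) fun y hy => (indicator_of_mem ?_ _).symm
      have h1 : r₀ / 2 ^ k ≤ r₀ := div_le_self hr₀.le (one_le_pow₀ one_le_two)
      have h2 := dist_triangle y x 0
      rw [mem_closedBall] at hy ⊢
      rw [mem_ball] at hxN
      linarith
    simpa only [heq] using hx
  filter_upwards [ae_all_iff.2 hloc] with x hx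
  obtain ⟨N, hN⟩ := exists_nat_gt (dist x 0)
  exact hx N hN

end LocalFiniteness

section FiniteArea

open scoped ENNReal

variable {β : ℝ}

/-- The integrand of the intrinsic area function, extended by zero to `t ≤ 0`. -/
def areaDensity (β : ℝ) (f : Rn n → ℝ) : Rn n × ℝ → ℝ≥0∞ :=
  {p | 0 < p.2}.indicator fun p => ENNReal.ofReal (Abeta β f p.1 p.2 ^ 2 / p.2 ^ (n + 1))

lemma areaDensity_of_pos (f : Rn n → ℝ) (y : Rn n) {t : ℝ} (ht : 0 < t) :
    areaDensity β f (y, t) = ENNReal.ofReal (Abeta β f y t ^ 2 / t ^ (n + 1)) :=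
  indicator_of_mem (show (y, t) ∈ {p : Rn n × ℝ | 0 < p.2} from ht) _

lemma measurable_areaDensity (hβ : 0 < β) {f : Rn n → ℝ} (hf : LocallyIntegrable f) :
    Measurable (areaDensity β f) := by
  have hS : MeasurableSet {p : Rn n × ℝ | 0 < p.2} :=
    measurableSet_lt measurable_const measurable_snd
  have heq : areaDensity β f = {p : Rn n × ℝ | 0 < p.2}.indicator fun p => ENNReal.ofReal
      ({p : Rn n × ℝ | 0 < p.2}.indicator (fun p => Abeta β f p.1 p.2) p ^ 2 /
        p.2 ^ (n + 1)) := by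
    refine indicator_congr fun p hp => ?_
    rw [indicator_of_mem hp]
  rw [heq]
  exact ((((measurable_indicator_Abeta hβ hf).pow_const 2).div
    (measurable_snd.pow_const _)).ennreal_ofReal).indicator hS

lemma lintegral_indicator_areaDensity_Ioc_le (hβ : 0 < β) {f : Rn n → ℝ}
    (hf : LocallyIntegrable f) {γ : ℝ} (hγ : 0 < γ) (x : Rn n) (k : ℕ) :
    ∫⁻ p in ball x (γ / 2 ^ k) ×ˢ Ioc ((1 / 2 : ℝ) ^ (k + 1)) ((1 / 2) ^ k),
      {p : Rn n × ℝ | dist x p.1 < γ * p.2}.indicator (areaDensity β f) p ≤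
    ENNReal.ofReal (((2 * (γ + 1)) ^ ((n : ℝ) + β)) ^ 2 * 2 ^ n * γ ^ n * unitVol n) *
      ENNReal.ofReal (Abeta β f x ((γ + 1) / 2 ^ k) ^ 2) := by
  have hv := unitVol_pos (n := n)
  set A := Abeta β f x ((γ + 1) / 2 ^ k)
  have hA : 0 ≤ A := Abeta_nonneg _ _ _
  set c := (2 * (γ + 1)) ^ ((n : ℝ) + β)
  have hpt : ∀ p ∈ ball x (γ / 2 ^ k) ×ˢ Ioc ((1 / 2 : ℝ) ^ (k + 1)) ((1 / 2) ^ k),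
      {p : Rn n × ℝ | dist x p.1 < γ * p.2}.indicator (areaDensity β f) p ≤
        ENNReal.ofReal (c ^ 2 * A ^ 2 * (2 ^ (k + 1)) ^ (n + 1)) := by
    rintro ⟨y, t⟩ ⟨-, ht1, ht2⟩
    simp only at ht1 ht2
    have ht0 : 0 < t := (by positivity : (0 : ℝ) < (1 / 2) ^ (k + 1)).trans ht1
    by_cases hp : (y, t) ∈ {p : Rn n × ℝ | dist x p.1 < γ * p.2}
    · rw [indicator_of_mem hp, areaDensity_of_pos _ _ ht0]
      have hp : dist x y < γ * t := hp
      have hts : t ≤ 1 / 2 ^ k := by rwa [one_div_pow] at ht2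
      have hts' : 1 / t ≤ 2 ^ (k + 1) := by
        rw [one_div_pow] at ht1
        rw [div_le_iff₀ ht0]
        rw [div_lt_iff₀ (by positivity)] at ht1
        linarith
      have h1 : Abeta β f y t ≤ ((γ + 1) / 2 ^ k / t) ^ ((n : ℝ) + β) * A := by
        refine Abeta_le_mul_Abeta hβ hf ht0 ?_
        rw [dist_comm]
        calc dist x y + t ≤ (γ + 1) * t := by linarith
          _ ≤ (γ + 1) * (1 / 2 ^ k) := by gcongr
          _ = _ := by ring
      have h2 : (γ + 1) / 2 ^ k / t ≤ 2 * (γ + 1) := by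
        calc (γ + 1) / 2 ^ k / t = (γ + 1) / 2 ^ k * (1 / t) := by ring
          _ ≤ (γ + 1) / 2 ^ k * 2 ^ (k + 1) := by gcongr
          _ = _ := by rw [pow_succ]; field_simp
      have h3 : Abeta β f y t ≤ c * A := h1.trans (by simp only [c]; gcongr)
      refine ENNReal.ofReal_le_ofReal ?_
      calc Abeta β f y t ^ 2 / t ^ (n + 1) = Abeta β f y t ^ 2 * (1 / t) ^ (n + 1) := by
            rw [one_div_pow]; ring
        _ ≤ (c * A) ^ 2 * (2 ^ (k + 1)) ^ (n + 1) := by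
            have := Abeta_nonneg (β := β) f y t
            gcongr
        _ = _ := by rw [mul_pow]
    · rw [indicator_of_notMem hp]
      exact zero_le
  refine (setLIntegral_mono measurable_const hpt).trans_eq ?_
  rw [setLIntegral_const, Measure.volume_eq_prod, Measure.prod_prod, Real.volume_Ioc,
    volume_ball_Rn _ (by positivity), ← ENNReal.ofReal_mul (by positivity),
    ← ENNReal.ofReal_mul (by positivity), ← ENNReal.ofReal_mul (by positivity)]
  congr 1
  have hu : (0 : ℝ) < 2 ^ k := by positivity
  rw [one_div, inv_pow, inv_pow, pow_succ (2 : ℝ) k, pow_succ (2 ^ k * 2 : ℝ) n, mul_pow, div_pow]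
  generalize (2 : ℝ) ^ k = u at hu
  field_simp
  ring

lemma setLIntegral_indicator_areaDensity_le (hβ : 0 < β) {f : Rn n → ℝ}
    (hf : LocallyIntegrable f) {γ : ℝ} (hγ : 0 < γ) (x : Rn n) :
    ∫⁻ p in {p : Rn n × ℝ | p.2 ≤ 1},
      {p : Rn n × ℝ | dist x p.1 < γ * p.2}.indicator (areaDensity β f) p ≤
    ENNReal.ofReal (((2 * (γ + 1)) ^ ((n : ℝ) + β)) ^ 2 * 2 ^ n * γ ^ n * unitVol n) *
      ∑' k : ℕ, ENNReal.ofReal (Abeta β f x ((γ + 1) / 2 ^ k) ^ 2) := by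
  set F := {p : Rn n × ℝ | dist x p.1 < γ * p.2}.indicator (areaDensity β f)
  set E : ℕ → Set (Rn n × ℝ) := fun k =>
    ball x (γ / 2 ^ k) ×ˢ Ioc ((1 / 2 : ℝ) ^ (k + 1)) ((1 / 2) ^ k)
  have hE : MeasurableSet {p : Rn n × ℝ | p.2 ≤ 1} :=
    measurableSet_le measurable_snd measurable_const
  have hsub : ∀ p : Rn n × ℝ, p ∈ {p : Rn n × ℝ | p.2 ≤ 1} → F p ≤ (⋃ k, E k).indicator F p := by
    rintro ⟨y, t⟩ ht
    have ht : t ≤ 1 := ht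
    by_cases hp : (y, t) ∈ {p : Rn n × ℝ | dist x p.1 < γ * p.2}
    · have hp' : dist x y < γ * t := hp
      have ht0 : 0 < t := pos_of_mul_pos_right (dist_nonneg.trans_lt hp') hγ.le
      obtain ⟨k, hk1, hk2⟩ := exists_nat_pow_near_of_lt_one ht0 ht
        (by norm_num : (0 : ℝ) < 1 / 2) (by norm_num)
      have hmem : (y, t) ∈ E k := by
        refine ⟨?_, hk1, hk2⟩
        rw [mem_ball, dist_comm]
        refine hp'.trans_le ?_
        rw [one_div_pow] at hk2
        calc γ * t ≤ γ * (1 / 2 ^ k) := by gcongr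
          _ = _ := by ring
      exact (indicator_of_mem (mem_iUnion.2 ⟨k, hmem⟩) F).ge
    · simp only [F, indicator_of_notMem hp]
      exact zero_le
  have hEm : ∀ k, MeasurableSet (E k) := fun k => measurableSet_ball.prod measurableSet_Ioc
  calc ∫⁻ p in {p : Rn n × ℝ | p.2 ≤ 1}, F p
      ≤ ∫⁻ p, (⋃ k, E k).indicator F p :=
        (setLIntegral_mono' hE hsub).trans (setLIntegral_le_lintegral _ _)
    _ = ∫⁻ p in ⋃ k, E k, F p := lintegral_indicator (MeasurableSet.iUnion hEm) _
    _ ≤ ∑' k, ∫⁻ p in E k, F p := lintegral_iUnion_le _ _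
    _ ≤ _ := by
        rw [← ENNReal.tsum_mul_left]
        exact ENNReal.tsum_le_tsum fun k => lintegral_indicator_areaDensity_Ioc_le hβ hf hγ x k

lemma lintegral_comp_mul_snd {F : Rn n × ℝ → ℝ≥0∞} (hF : Measurable F) {L : ℝ} (hL : 0 < L) :
    ∫⁻ p : Rn n × ℝ, F (p.1, L * p.2) = ENNReal.ofReal L⁻¹ * ∫⁻ p, F p := by
  have hFL : Measurable fun p : Rn n × ℝ => F (p.1, L * p.2) :=
    hF.comp (measurable_fst.prodMk (measurable_snd.const_mul L))
  rw [Measure.volume_eq_prod, lintegral_prod _ hFL.aemeasurable, lintegral_prod _ hF.aemeasurable,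
    ← lintegral_const_mul _ hF.lintegral_prod_right']
  refine lintegral_congr fun y => ?_
  have hFy : Measurable fun t => F (y, t) := hF.comp measurable_prodMk_left
  rw [← lintegral_map (f := fun t => F (y, t)) hFy (measurable_const_mul L),
    Real.map_volume_mul_left hL.ne', lintegral_smul_measure, abs_of_pos (by positivity)]
  rfl

lemma setLIntegral_indicator_areaDensity_le_coneInt (hβ : 0 < β) {f : Rn n → ℝ}
    (hf : LocallyIntegrable f) {γ : ℝ} (hγ : 0 < γ) (x x₀ : Rn n) :
    ∃ C : ℝ, ∫⁻ p in {p : Rn n × ℝ | p.2 ≤ 1}ᶜ,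
      {p : Rn n × ℝ | dist x p.1 < γ * p.2}.indicator (areaDensity β f) p ≤
      ENNReal.ofReal C * coneInt volume (areaDensity β f) 1 x₀ := by
  set R := dist x₀ x
  have hR : 0 ≤ R := dist_nonneg
  set L := R + γ + 1
  have hL : 0 < L := by positivity
  set F := {p : Rn n × ℝ | dist x p.1 < γ * p.2}.indicator (areaDensity β f)
  set F₀ := {p : Rn n × ℝ | dist x₀ p.1 < 1 * p.2}.indicator (areaDensity β f)
  have hF₀ : Measurable F₀ := (measurable_areaDensity hβ hf).indicator
    (measurableSet_lt (measurable_const.dist measurable_fst) (measurable_snd.const_mul 1))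
  set c := L ^ ((n : ℝ) + β)
  have hE : MeasurableSet {p : Rn n × ℝ | p.2 ≤ 1}ᶜ :=
    (measurableSet_le measurable_snd measurable_const).compl
  have hle : ∀ p ∈ {p : Rn n × ℝ | p.2 ≤ 1}ᶜ,
      F p ≤ ENNReal.ofReal (c ^ 2 * L ^ (n + 1)) * F₀ (p.1, L * p.2) := by
    rintro ⟨y, t⟩ ht
    have ht : 1 < t := not_le.1 ht
    have ht0 : 0 < t := by linarith
    by_cases hp : (y, t) ∈ {p : Rn n × ℝ | dist x p.1 < γ * p.2}
    · have hp' : dist x y < γ * t := hp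
      have hmem : (y, L * t) ∈ {p : Rn n × ℝ | dist x₀ p.1 < 1 * p.2} := by
        change dist x₀ y < 1 * (L * t)
        have h1 := dist_triangle x₀ x y
        have h2 : R ≤ R * t := le_mul_of_one_le_right hR ht.le
        have h3 : L * t = R * t + γ * t + t := by ring
        linarith
      simp only [F, F₀]
      rw [indicator_of_mem hp, indicator_of_mem hmem, areaDensity_of_pos _ _ ht0,
        areaDensity_of_pos _ _ (by positivity), ← ENNReal.ofReal_mul (by positivity)]
      refine ENNReal.ofReal_le_ofReal ?_
      have h4 : Abeta β f y t ≤ (L * t / t) ^ ((n : ℝ) + β) * Abeta β f y (L * t) := by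
        refine Abeta_le_mul_Abeta hβ hf ht0 ?_
        rw [dist_self, zero_add]
        exact le_mul_of_one_le_left ht0.le (by linarith)
      rw [mul_div_cancel_right₀ _ ht0.ne'] at h4
      calc Abeta β f y t ^ 2 / t ^ (n + 1) ≤ (c * Abeta β f y (L * t)) ^ 2 / t ^ (n + 1) := by
            have := Abeta_nonneg (β := β) f y t
            gcongr
        _ = _ := by rw [mul_pow, mul_pow L]; field_simp
    · simp only [F, indicator_of_notMem hp]
      exact zero_le
  refine ⟨c ^ 2 * L ^ (n + 1) * L⁻¹, ?_⟩
  calc ∫⁻ p in {p : Rn n × ℝ | p.2 ≤ 1}ᶜ, F p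
      ≤ ∫⁻ p : Rn n × ℝ, ENNReal.ofReal (c ^ 2 * L ^ (n + 1)) * F₀ (p.1, L * p.2) :=
        (setLIntegral_mono' hE hle).trans (setLIntegral_le_lintegral _ _)
    _ = _ := by
        have hF₀L : Measurable fun p : Rn n × ℝ => F₀ (p.1, L * p.2) :=
          hF₀.comp (measurable_fst.prodMk (measurable_snd.const_mul L))
        rw [lintegral_const_mul _ hF₀L, lintegral_comp_mul_snd hF₀ hL, ← mul_assoc,
          ← ENNReal.ofReal_mul (by positivity)]
        rfl

/-- If the intrinsic area function is finite at one point, then the area functions of all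
apertures are finite almost everywhere. -/
lemma ae_coneInt_areaDensity_lt_top (hβ : 0 < β) {f : Rn n → ℝ} (hf : LocallyIntegrable f)
    {γ : ℝ} (hγ : 0 < γ) {x₀ : Rn n} (hx₀ : coneInt volume (areaDensity β f) 1 x₀ < ∞) :
    ∀ᵐ x, coneInt volume (areaDensity β f) γ x < ∞ := by
  filter_upwards [ae_tsum_Abeta_sq_lt_top hβ hf (by positivity : 0 < γ + 1)] with x hx
  obtain ⟨C, hC⟩ := setLIntegral_indicator_areaDensity_le_coneInt hβ hf hγ x x₀
  rw [coneInt, ← lintegral_add_compl _ (measurableSet_le measurable_snd measurable_const :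
    MeasurableSet {p : Rn n × ℝ | p.2 ≤ 1})]
  exact ENNReal.add_lt_top.2
    ⟨(setLIntegral_indicator_areaDensity_le hβ hf hγ x).trans_lt
      (ENNReal.mul_lt_top ENNReal.ofReal_lt_top hx),
    hC.trans_lt (ENNReal.mul_lt_top ENNReal.ofReal_lt_top hx₀)⟩

end FiniteArea

section MuckenhouptWeight

open scoped ENNReal

/-- The measure `w(x) dx`. -/
def weightMeasure (w : Rn n → ℝ) : Measure (Rn n) :=
  volume.withDensity fun x => ENNReal.ofReal (w x)

instance (w : Rn n → ℝ) : SigmaFinite (weightMeasure w) :=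
  SigmaFinite.withDensity fun x => (w x).toNNReal

variable {w : Rn n → ℝ} {Cw : ℝ}

lemma IsA1.integrableOn_ball (hw : IsA1 w Cw) (x : Rn n) (r : ℝ) : IntegrableOn w (ball x r) :=
  (hw.2.1.integrableOn_isCompact (isCompact_closedBall x r)).mono_set ball_subset_closedBall

lemma IsA1.weightMeasure_ball (hw : IsA1 w Cw) (x : Rn n) (r : ℝ) :
    weightMeasure w (ball x r) = ENNReal.ofReal (∫ y in ball x r, w y) := by
  rw [weightMeasure, withDensity_apply _ measurableSet_ball,
    ofReal_integral_eq_lintegral_ofReal (hw.integrableOn_ball x r) (ae_of_all _ hw.1)]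

lemma IsA1.setIntegral_ball_le (hw : IsA1 w Cw) {γ : ℝ} (hγ : 1 ≤ γ) (x : Rn n) {r : ℝ}
    (hr : 0 < r) : ∫ y in ball x (γ * r), w y ≤ |Cw| * γ ^ n * ∫ y in ball x r, w y := by
  have hv := unitVol_pos (n := n)
  have hγr : 0 < γ * r := by positivity
  set e := essInf w (volume.restrict (ball x (γ * r)))
  have he : 0 ≤ e := by
    refine Real.sSup_nonneg' ⟨0, ?_, le_rfl⟩
    exact Filter.eventually_map.2 (ae_of_all _ hw.1)
  have hvol : ∀ {s : ℝ}, 0 < s → (volume (ball x s)).toReal = s ^ n * unitVol n := fun hs => by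
    rw [volume_ball_Rn x hs, ENNReal.toReal_ofReal (by positivity)]
  have hsub : ball x r ⊆ ball x (γ * r) := ball_subset_ball (le_mul_of_one_le_left hr.le hγ)
  have hew : ∀ᵐ y ∂volume.restrict (ball x r), e ≤ w y :=
    ae_restrict_of_ae_restrict_of_subset hsub
      (ae_essInf_le (hf := ⟨0, Filter.eventually_map.2 (ae_of_all _ hw.1)⟩))
  have h1 : r ^ n * unitVol n * e ≤ ∫ y in ball x r, w y := by
    have h := setIntegral_mono_ae_restrict (integrableOn_const measure_ball_lt_top.ne)
      (hw.integrableOn_ball x r) hew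
    rwa [setIntegral_const, Measure.real, hvol hr, smul_eq_mul] at h
  calc ∫ y in ball x (γ * r), w y ≤ Cw * (volume (ball x (γ * r))).toReal * e := hw.2.2 x _ hγr
    _ ≤ |Cw| * (volume (ball x (γ * r))).toReal * e := by gcongr; exact le_abs_self _
    _ = |Cw| * γ ^ n * (r ^ n * unitVol n * e) := by rw [hvol hγr, mul_pow]; ring
    _ ≤ _ := by gcongr

/-- `A₁` weights are doubling. -/
lemma IsA1.weightMeasure_ball_mul_le (hw : IsA1 w Cw) {γ : ℝ} (hγ : 1 ≤ γ) (x : Rn n) (r : ℝ) :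
    weightMeasure w (ball x (γ * r)) ≤
      ENNReal.ofReal (|Cw| * γ ^ n) * weightMeasure w (ball x r) := by
  rcases le_or_gt r 0 with hr | hr
  · rw [ball_eq_empty.2 (mul_nonpos_of_nonneg_of_nonpos (by linarith) hr), measure_empty]
    exact zero_le
  · rw [hw.weightMeasure_ball, hw.weightMeasure_ball, ← ENNReal.ofReal_mul (by positivity)]
    exact ENNReal.ofReal_le_ofReal (hw.setIntegral_ball_le hγ x hr)

end MuckenhouptWeight

section AreaFunction

open scoped ENNReal

variable {β : ℝ}

lemma SbetaA_eq_rpow_coneInt (hβ : 0 < β) {f : Rn n → ℝ} (hf : LocallyIntegrable f) (γ : ℝ)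
    (x : Rn n) :
    SbetaA β γ f x = (coneInt volume (areaDensity β f) γ x).toReal ^ (1 / 2 : ℝ) := by
  have hS : MeasurableSet {p : Rn n × ℝ | dist x p.1 < γ * p.2 ∧ 0 < p.2} :=
    (measurableSet_lt (measurable_const.dist measurable_fst) (measurable_snd.const_mul γ)).inter
      (measurableSet_lt measurable_const measurable_snd)
  have hnn : ∀ p ∈ {p : Rn n × ℝ | dist x p.1 < γ * p.2 ∧ 0 < p.2},
      0 ≤ Abeta β f p.1 p.2 ^ 2 / p.2 ^ (n + 1) := fun p hp => by
    have : 0 < p.2 := hp.2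
    positivity
  have hmeas : AEStronglyMeasurable (fun p : Rn n × ℝ => Abeta β f p.1 p.2 ^ 2 / p.2 ^ (n + 1))
      (volume.restrict {p : Rn n × ℝ | dist x p.1 < γ * p.2 ∧ 0 < p.2}) := by
    have hm : Measurable fun p : Rn n × ℝ => (areaDensity β f p).toReal :=
      (measurable_areaDensity hβ hf).ennreal_toReal
    refine hm.aestronglyMeasurable.congr ((ae_restrict_iff' hS).2 (ae_of_all _ fun p hp => ?_))
    have := areaDensity_of_pos (β := β) f p.1 hp.2
    simp only
    rw [show p = (p.1, p.2) from rfl, this, ENNReal.toReal_ofReal (hnn p hp)]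
  rw [SbetaA, integral_eq_lintegral_of_nonneg_ae ((ae_restrict_iff' hS).2 (ae_of_all _ hnn)) hmeas,
    ← lintegral_indicator hS, coneInt]
  congr 3
  ext p
  by_cases h1 : dist x p.1 < γ * p.2 <;> by_cases h2 : 0 < p.2 <;>
    simp [indicator, areaDensity, h1, h2]

lemma wLq_SbetaA (hβ : 0 < β) {f : Rn n → ℝ} (hf : LocallyIntegrable f) {q : ℝ} (hq : 0 < q)
    {w : Rn n → ℝ} (hw0 : ∀ x, 0 ≤ w x) (hw : AEMeasurable w) {γ : ℝ}
    (hfin : ∀ᵐ x, coneInt volume (areaDensity β f) γ x < ∞) :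
    wLq q w (SbetaA β γ f) =
      (∫⁻ x, coneInt volume (areaDensity β f) γ x ^ (q / 2) ∂weightMeasure w).toReal ^ (1 / q) := by
  set G := coneInt volume (areaDensity β f) γ
  have hG : Measurable G := measurable_coneInt _ (measurable_areaDensity hβ hf) γ
  have hS : ∀ x, |SbetaA β γ f x| ^ q = (G x).toReal ^ (q / 2) := fun x => by
    rw [SbetaA_eq_rpow_coneInt hβ hf, abs_of_nonneg (by positivity),
      ← Real.rpow_mul ENNReal.toReal_nonneg]
    congr 1
    ring
  have hmeas : AEMeasurable (fun x => (G x).toReal ^ (q / 2) * w x) volume :=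
    (hG.ennreal_toReal.pow_const _).aemeasurable.mul hw
  rw [wLq]
  simp only [hS]
  rw [integral_eq_lintegral_of_nonneg_ae
    (ae_of_all _ fun x => mul_nonneg (by positivity) (hw0 x)) hmeas.aestronglyMeasurable,
    weightMeasure, lintegral_withDensity_eq_lintegral_mul₀ hw.ennreal_ofReal
      (hG.pow_const _).aemeasurable]
  congr 2
  refine lintegral_congr_ae (hfin.mono fun x hx => ?_)
  simp only [Pi.mul_apply]
  rw [ENNReal.ofReal_mul (by positivity), ← ENNReal.ofReal_rpow_of_nonneg ENNReal.toReal_nonneg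
    (by positivity), ENNReal.ofReal_toReal hx.ne, mul_comm]

lemma coneInt_one_le (f : Rn n → ℝ) {γ : ℝ} (hγ : 1 ≤ γ) (x : Rn n) :
    coneInt volume (areaDensity β f) 1 x ≤ coneInt volume (areaDensity β f) γ x := by
  refine lintegral_mono fun p => indicator_le_indicator_of_subset (fun p hp => ?_)
    (fun _ => zero_le) p
  have hp : dist x p.1 < 1 * p.2 := hp
  have h0 : 0 < p.2 := by linarith [dist_nonneg (x := x) (y := p.1)]
  exact hp.trans_le (by gcongr)

lemma wLq_nonneg {q : ℝ} {w g : Rn n → ℝ} (hw0 : ∀ x, 0 ≤ w x) : 0 ≤ wLq q w g :=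
  Real.rpow_nonneg (integral_nonneg fun x => mul_nonneg (by positivity) (hw0 x)) _

/-- Change of aperture for the intrinsic area function in `L^q_w`, `q > 2`. -/
lemma exists_wLq_SbetaA_le (hβ : 0 < β) {q : ℝ} (hq : 2 < q) {w : Rn n → ℝ} {Cw : ℝ}
    (hw : IsA1 w Cw) :
    ∃ M : ℝ, 0 ≤ M ∧ ∀ (γ : ℝ) (f : Rn n → ℝ), 1 ≤ γ → LocallyIntegrable f →
      wLq q w (SbetaA β γ f) ≤ (M * γ ^ n) ^ (1 / 2 : ℝ) * wLq q w (SbetaA β 1 f) := by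
  set p := q / 2
  have hp : 1 < p := by simp only [p]; linarith
  have hpq : p.HolderConjugate p.conjExponent := Real.HolderConjugate.conjExponent hp
  set M₀ : ℝ≥0∞ := (ENNReal.ofReal (p.conjExponent * 2 ^ p.conjExponent / (p.conjExponent - 1)) *
    ENNReal.ofReal (|Cw| * 4 ^ n)) ^ (1 / p.conjExponent)
  have hM₀ : M₀ ≠ ∞ := ENNReal.rpow_ne_top_of_nonneg (by have := hpq.symm.pos; positivity)
    (ENNReal.mul_ne_top ENNReal.ofReal_ne_top ENNReal.ofReal_ne_top)
  refine ⟨|Cw| * M₀.toReal, by positivity, fun γ f hγ hf => ?_⟩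
  have hγ0 : 0 < γ := by linarith
  by_cases hx₀ : ∃ x₀, coneInt volume (areaDensity β f) 1 x₀ < ∞
  · obtain ⟨x₀, hx₀⟩ := hx₀
    have hwm : AEMeasurable w := hw.2.1.aestronglyMeasurable.aemeasurable
    rw [wLq_SbetaA hβ hf (by linarith) hw.1 hwm (ae_coneInt_areaDensity_lt_top hβ hf hγ0 hx₀),
      wLq_SbetaA hβ hf (by linarith) hw.1 hwm (ae_coneInt_areaDensity_lt_top hβ hf one_pos hx₀)]
    have hmain : _ ≤ ENNReal.ofReal (|Cw| * γ ^ n) * M₀ * _ :=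
      lintegral_coneInt_rpow_le (μ := weightMeasure w) (ν := volume)
      (D := ENNReal.ofReal (|Cw| * γ ^ n)) hγ hp
      (fun x r => by rw [hw.weightMeasure_ball]; exact ENNReal.ofReal_ne_top)
      (hw.weightMeasure_ball_mul_le (by norm_num : (1 : ℝ) ≤ 4)) ENNReal.ofReal_ne_top
      (hw.weightMeasure_ball_mul_le hγ) (measurable_areaDensity hβ hf)
    have hmono : ∫⁻ x, coneInt volume (areaDensity β f) 1 x ^ p ∂weightMeasure w ≤
        ∫⁻ x, coneInt volume (areaDensity β f) γ x ^ p ∂weightMeasure w :=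
      lintegral_mono fun x => ENNReal.rpow_le_rpow (coneInt_one_le f hγ x) (by linarith)
    set X₁ := ∫⁻ x, coneInt volume (areaDensity β f) 1 x ^ p ∂weightMeasure w
    set X := ∫⁻ x, coneInt volume (areaDensity β f) γ x ^ p ∂weightMeasure w
    by_cases hX : X = ∞
    · rw [hX, ENNReal.toReal_top, Real.zero_rpow (by positivity)]
      positivity
    have hX₁ : X₁ ≠ ∞ := ne_top_of_le_ne_top hX hmono
    have hreal : X.toReal ^ (1 / p) ≤ |Cw| * M₀.toReal * γ ^ n * X₁.toReal ^ (1 / p) := by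
      have h := ENNReal.toReal_mono (ENNReal.mul_ne_top (ENNReal.mul_ne_top ENNReal.ofReal_ne_top
        hM₀) (ENNReal.rpow_ne_top_of_nonneg (by positivity) hX₁)) hmain
      rw [ENNReal.toReal_mul, ENNReal.toReal_mul, ← ENNReal.toReal_rpow,
        ← ENNReal.toReal_rpow X₁, ENNReal.toReal_ofReal (by positivity)] at h
      refine h.trans_eq ?_
      ring
    have hexp : 1 / q = 1 / p * (1 / 2) := by simp only [p]; field_simp
    rw [hexp, Real.rpow_mul ENNReal.toReal_nonneg, Real.rpow_mul ENNReal.toReal_nonneg,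
      ← Real.mul_rpow (by positivity) (by positivity)]
    exact Real.rpow_le_rpow (by positivity) hreal (by norm_num)
  · push Not at hx₀
    have htop : ∀ x, SbetaA β γ f x = 0 := fun x => by
      have h : coneInt volume (areaDensity β f) γ x = ∞ :=
        top_le_iff.1 ((hx₀ x).trans (coneInt_one_le f hγ x))
      rw [SbetaA_eq_rpow_coneInt hβ hf, h, ENNReal.toReal_top, Real.zero_rpow (by norm_num)]
    have h0 : wLq q w (SbetaA β γ f) = 0 := by
      simp only [wLq, htop, abs_zero]
      rw [Real.zero_rpow (by positivity)]
      simp only [zero_mul, integral_zero]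
      exact Real.zero_rpow (by positivity)
    rw [h0]
    exact mul_nonneg (by positivity) (wLq_nonneg hw.1)

end AreaFunction

/-- aperture comparison in `L^q_w`, `2 < q < ∞`:
`‖S_{β,2^j}(f)‖_{L^q_w} ≤ C 2^{jn/2} ‖S_β(f)‖_{L^q_w}`. -/
theorem stmt8 (β Cw q : ℝ) (hβ : 0 < β) (hβ1 : β ≤ 1) (hq : 2 < q)
    (w : Rn n → ℝ) (hw : IsA1 w Cw) :
    ∃ C > 0, ∀ (j : ℕ) (f : Rn n → ℝ), MeasureTheory.LocallyIntegrable f →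
      wLq q w (SbetaA β ((2 : ℝ) ^ j) f) ≤
        C * (2 : ℝ) ^ ((j : ℝ) * (n : ℝ) / 2) * wLq q w (SbetaA β 1 f) := by
  obtain ⟨M, hM0, hM⟩ := exists_wLq_SbetaA_le hβ hq hw
  refine ⟨M ^ (1 / 2 : ℝ) + 1, by positivity, fun j f hf => ?_⟩
  refine (hM _ f (one_le_pow₀ one_le_two) hf).trans ?_
  have hpow : (((2 : ℝ) ^ j) ^ n) ^ (1 / 2 : ℝ) = 2 ^ ((j : ℝ) * (n : ℝ) / 2) := by
    rw [← pow_mul, ← Real.rpow_natCast, ← Real.rpow_mul zero_le_two]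
    push_cast
    ring_nf
  rw [Real.mul_rpow hM0 (by positivity), hpow]
  refine mul_le_mul_of_nonneg_right ?_ (wLq_nonneg hw.1)
  gcongr
  linarith
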